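/- arXiv:2202.08323 — 7 statements merged into one kernel-verified Lean document; each statement's English description precedes it below -/
import Mathlib

section
/- Let d ≥ 1 and let 0 < u ≤ 1. Let n be a d×d real upper triangular matrix all of whose diagonal entries equal 1, let a be the diagonal matrix with diagonal entries a_1, …, a_d > 0 satisfying a_j / a_{j+1} > u for all 1 ≤ j ≤ d−1, and let k be a d×d real orthogonal matrix. Set g = n·a·k. Then: (i) for every nonzero v ∈ ℤ^d one has ‖v·g‖ ≥ a_d · u^{d−1}; and (ii) the d-th standard basis row vector e_d satisfies ‖e_d·g‖ = a_d. Consequently a_d·u^{d−1} ≤ s(g) ≤ a_d. -/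
open Matrix

/-- The Euclidean norm of a vector in `ℝ^d`. -/
noncomputable def euclNorm {d : ℕ} (v : Fin d → ℝ) : ℝ :=
  Real.sqrt (∑ i, v i ^ 2)

/-- The systole of a matrix `g`: the length of a shortest nonzero vector of the
lattice `ℤ^d · g`. -/
noncomputable def systole {d : ℕ} (g : Matrix (Fin d) (Fin d) ℝ) : ℝ :=
  sInf {r : ℝ | ∃ v : Fin d → ℤ, v ≠ 0 ∧ r = euclNorm ((fun i => (v i : ℝ)) ᵥ* g)}

theorem abs_apply_le_euclNorm {d : ℕ} (v : Fin d → ℝ) (i : Fin d) : |v i| ≤ euclNorm v :=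
  Real.abs_le_sqrt (Finset.single_le_sum (f := fun j => v j ^ 2) (fun j _ => sq_nonneg (v j))
    (Finset.mem_univ i))

theorem euclNorm_eq_sqrt_dotProduct {d : ℕ} (v : Fin d → ℝ) : euclNorm v = √(v ⬝ᵥ v) := by
  simp only [euclNorm, dotProduct, sq]

theorem euclNorm_vecMul_of_mem_orthogonalGroup {d : ℕ} {k : Matrix (Fin d) (Fin d) ℝ}
    (hk : k ∈ Matrix.orthogonalGroup (Fin d) ℝ) (w : Fin d → ℝ) :
    euclNorm (w ᵥ* k) = euclNorm w := by
  have hk' : k * kᵀ = 1 := by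
    simpa [star_eq_conjTranspose] using (Matrix.mem_orthogonalGroup_iff (Fin d) ℝ).1 hk
  rw [euclNorm_eq_sqrt_dotProduct, euclNorm_eq_sqrt_dotProduct, ← dotProduct_mulVec,
    ← vecMul_transpose, vecMul_vecMul, hk', vecMul_one]

theorem mul_pow_le_of_lt_div_succ {d : ℕ} {u : ℝ} (hu0 : 0 < u) {α : Fin d → ℝ}
    (hαpos : ∀ i, 0 < α i)
    (hαu : ∀ i j : Fin d, (i : ℕ) + 1 = (j : ℕ) → u < α i / α j) (m : ℕ) :
    ∀ i j : Fin d, (i : ℕ) + m = j → α j * u ^ m ≤ α i := by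
  induction m with
  | zero =>
    intro i j h
    obtain rfl : i = j := Fin.ext h
    simp
  | succ m ih =>
    intro i j h
    obtain ⟨l, hl⟩ : ∃ l : Fin d, (i : ℕ) + 1 = l := ⟨⟨i + 1, by omega⟩, rfl⟩
    calc α j * u ^ (m + 1) = u * (α j * u ^ m) := by ring
      _ ≤ u * α l := mul_le_mul_of_nonneg_left (ih l j (by omega)) hu0.le
      _ ≤ α i := ((lt_div_iff₀ (hαpos l)).1 (hαu i l hl)).le

theorem mul_pow_pred_le {d : ℕ} {u : ℝ} (hu0 : 0 < u) (hu1 : u ≤ 1) {α : Fin d → ℝ}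
    (hαpos : ∀ i, 0 < α i)
    (hαu : ∀ i j : Fin d, (i : ℕ) + 1 = (j : ℕ) → u < α i / α j) {i j : Fin d} (hij : i ≤ j) :
    α j * u ^ (d - 1) ≤ α i :=
  (mul_le_mul_of_nonneg_left (pow_le_pow_of_le_one hu0.le hu1 (by omega)) (hαpos j).le).trans
    (mul_pow_le_of_lt_div_succ hu0 hαpos hαu (j - i) i j (by omega))

theorem exists_first_ne_zero {d : ℕ} {v : Fin d → ℤ} (hv : v ≠ 0) :
    ∃ i, v i ≠ 0 ∧ ∀ j < i, v j = 0 := by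
  obtain ⟨i, hi, hmin⟩ := WellFounded.has_min (wellFounded_lt (α := Fin d)) {i | v i ≠ 0}
    (Function.ne_iff.1 hv)
  exact ⟨i, hi, fun j hj => by_contra fun h => hmin j h hj⟩

theorem vecMul_upperUnitriangular_apply {d : ℕ} {n : Matrix (Fin d) (Fin d) ℝ}
    (hn_diag : ∀ i, n i i = 1) (hn_tri : ∀ i j : Fin d, j < i → n i j = 0)
    {w : Fin d → ℝ} {i : Fin d} (hw : ∀ j < i, w j = 0) : (w ᵥ* n) i = w i := by
  rw [vecMul, dotProduct, Finset.sum_eq_single i]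
  · rw [hn_diag, mul_one]
  · intro j _ hj
    rcases lt_or_gt_of_ne hj with h | h
    · rw [hw j h, zero_mul]
    · rw [hn_tri j i h, mul_zero]
  · simp

theorem stmt0 (d : ℕ) (hd : 1 ≤ d) (u : ℝ) (hu0 : 0 < u) (hu1 : u ≤ 1)
    (n a k g : Matrix (Fin d) (Fin d) ℝ)
    (hn_diag : ∀ i, n i i = 1) (hn_tri : ∀ i j : Fin d, j < i → n i j = 0)
    (α : Fin d → ℝ) (ha : a = Matrix.diagonal α) (hαpos : ∀ i, 0 < α i)
    (hαu : ∀ i j : Fin d, (i : ℕ) + 1 = (j : ℕ) → u < α i / α j)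
    (hk : k ∈ Matrix.orthogonalGroup (Fin d) ℝ)
    (hg : g = n * a * k) :
    (∀ v : Fin d → ℤ, v ≠ 0 →
      α ⟨d - 1, by omega⟩ * u ^ (d - 1) ≤ euclNorm ((fun i => (v i : ℝ)) ᵥ* g)) ∧
    euclNorm ((Pi.single (⟨d - 1, by omega⟩ : Fin d) 1 : Fin d → ℝ) ᵥ* g)
      = α ⟨d - 1, by omega⟩ ∧
    α ⟨d - 1, by omega⟩ * u ^ (d - 1) ≤ systole g ∧
    systole g ≤ α ⟨d - 1, by omega⟩ := by
  have hnorm (w : Fin d → ℝ) : euclNorm (w ᵥ* g) = euclNorm (w ᵥ* n ᵥ* diagonal α) := by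
    rw [hg, ha, ← vecMul_vecMul, ← vecMul_vecMul, euclNorm_vecMul_of_mem_orthogonalGroup hk]
  have lower : ∀ v : Fin d → ℤ, v ≠ 0 →
      α ⟨d - 1, by omega⟩ * u ^ (d - 1) ≤ euclNorm ((fun i => (v i : ℝ)) ᵥ* g) := by
    intro v hv
    obtain ⟨i, hi, hlt⟩ := exists_first_ne_zero hv
    rw [hnorm]
    have hle : i ≤ (⟨d - 1, by omega⟩ : Fin d) := Fin.le_def.2 (by simp only; omega)
    refine (mul_pow_pred_le hu0 hu1 hαpos hαu hle).trans (le_trans ?_ (abs_apply_le_euclNorm _ i))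
    rw [vecMul_diagonal, vecMul_upperUnitriangular_apply hn_diag hn_tri
      (fun j hj => by rw [hlt j hj, Int.cast_zero]), abs_mul, abs_of_pos (hαpos i)]
    exact le_mul_of_one_le_left (hαpos i).le (by exact_mod_cast Int.one_le_abs hi)
  have upper : euclNorm ((Pi.single (⟨d - 1, by omega⟩ : Fin d) 1 : Fin d → ℝ) ᵥ* g)
      = α ⟨d - 1, by omega⟩ := by
    have hrow : (Pi.single (⟨d - 1, by omega⟩ : Fin d) 1 : Fin d → ℝ) ᵥ* n
        = Pi.single ⟨d - 1, by omega⟩ 1 := by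
      ext j
      have hj : j ≤ (⟨d - 1, by omega⟩ : Fin d) := Fin.le_def.2 (by simp only; omega)
      exact vecMul_upperUnitriangular_apply hn_diag hn_tri
        fun i hi => Pi.single_eq_of_ne (hi.trans_le hj).ne 1
    rw [hnorm, hrow, single_vecMul_diagonal, one_mul, euclNorm_eq_sqrt_dotProduct,
      single_dotProduct, Pi.single_eq_same, Real.sqrt_mul_self (hαpos _).le]
  have mem : α ⟨d - 1, by omega⟩ ∈ {r : ℝ | ∃ v : Fin d → ℤ, v ≠ 0 ∧
      r = euclNorm ((fun i => (v i : ℝ)) ᵥ* g)} := by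
    refine ⟨Pi.single ⟨d - 1, by omega⟩ 1, by simp, ?_⟩
    rw [← upper]
    congr 2
    ext i
    simp [Pi.single_apply]
  refine ⟨lower, upper, le_csInf ⟨_, mem⟩ ?_, csInf_le ⟨α ⟨d - 1, by omega⟩ * u ^ (d - 1), ?_⟩ mem⟩
  all_goals
    rintro r ⟨v, hv, rfl⟩
    exact lower v hv
end

section
/- Let d ≥ 2 and let Γ be a finite-index subgroup of SL(d,ℤ), viewed as a subgroup of G = SL(d,ℝ). Let γ ∈ Γ be loxodromic, i.e. there exist g ∈ SL(d,ℝ) and a real diagonal matrix a whose diagonal entries have pairwise distinct absolute values such that γ = g·a·g⁻¹. Let F be the image, in the quotient space Γ\G (the orbit space of the left-multiplication action of Γ on G, equipped with the quotient topology), of the set {g·b : b a real diagonal d×d matrix with det b = 1}. Then F is compact if and only if the characteristic polynomial of γ is irreducible over ℚ. -/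
open Matrix

/-- `SL(d,ℝ)` carries the topology induced from the space of matrices. -/
noncomputable instance SLRtop (d : ℕ) :
    TopologicalSpace (Matrix.SpecialLinearGroup (Fin d) ℝ) :=
  TopologicalSpace.induced (fun g => (g : Matrix (Fin d) (Fin d) ℝ)) inferInstance

/-- The canonical morphism `SL(d,ℤ) →* SL(d,ℝ)`. -/
noncomputable def toSLR {d : ℕ} :
    Matrix.SpecialLinearGroup (Fin d) ℤ →* Matrix.SpecialLinearGroup (Fin d) ℝ :=
  Matrix.SpecialLinearGroup.map (Int.castRingHom ℝ)

open Polynomial in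
/-- If `M` is diagonalised over `ℝ` by `G`, so is every integer polynomial in `M`. -/
theorem map_aeval_mul_eq_mul_diagonal {d : ℕ} {M : Matrix (Fin d) (Fin d) ℤ}
    {G : Matrix (Fin d) (Fin d) ℝ} {δ : Fin d → ℝ}
    (h : M.map (Int.cast : ℤ → ℝ) * G = G * diagonal δ) (p : ℤ[X]) :
    (aeval M p).map (Int.cast : ℤ → ℝ) * G = G * diagonal (fun i => aeval (δ i) p) := by
  induction p using Polynomial.induction_on with
  | C a =>
    have h1 : (algebraMap ℤ (Matrix (Fin d) (Fin d) ℤ) a).map (Int.cast : ℤ → ℝ)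
        = diagonal (fun _ => (a : ℝ)) := by
      rw [Matrix.algebraMap_eq_diagonal, Matrix.diagonal_map (by simp)]
      rfl
    have h2 : (diagonal (fun _ : Fin d => (a : ℝ))) = (a : ℝ) • 1 := by
      rw [Matrix.smul_one_eq_diagonal]
    simp only [aeval_C, h1]
    simp [h2]
  | add p q hp hq =>
    have h1 : (aeval M p + aeval M q).map (Int.cast : ℤ → ℝ)
        = (aeval M p).map (Int.cast : ℤ → ℝ) + (aeval M q).map (Int.cast : ℤ → ℝ) :=
      Matrix.map_add _ (by simp) _ _
    simp only [map_add, h1]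
    rw [add_mul, hp, hq, ← mul_add, Matrix.diagonal_add]
  | monomial n a ih =>
    have h1 : aeval M (C a * X ^ (n + 1)) = aeval M (C a * X ^ n) * M := by
      simp [pow_succ, mul_assoc]
    have h2 : ∀ i, aeval (δ i) (C a * X ^ (n + 1)) = aeval (δ i) (C a * X ^ n) * δ i := by
      intro i; simp [pow_succ, mul_assoc]
    have h3 : (aeval M (C a * X ^ n) * M).map (Int.cast : ℤ → ℝ)
        = (aeval M (C a * X ^ n)).map (Int.cast : ℤ → ℝ) * M.map (Int.cast : ℤ → ℝ) :=
      Matrix.map_mul (f := Int.castRingHom ℝ)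
    rw [h1, h3, mul_assoc, h, ← mul_assoc, ih, mul_assoc, Matrix.diagonal_mul_diagonal]
    simp only [h2]

open Polynomial in
theorem aeval_charpoly_eq_zero_of_diagonalized {d : ℕ} {M : Matrix (Fin d) (Fin d) ℤ}
    {G : Matrix (Fin d) (Fin d) ℝ} (hG : IsUnit G) {δ : Fin d → ℝ}
    (h : M.map (Int.cast : ℤ → ℝ) * G = G * diagonal δ) (i : Fin d) :
    aeval (δ i) M.charpoly = 0 := by
  have h1 := map_aeval_mul_eq_mul_diagonal h M.charpoly
  rw [Matrix.aeval_self_charpoly] at h1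
  have h2 : G * diagonal (fun i => aeval (δ i) M.charpoly) = G * 0 := by
    rw [← h1]; simp
  have h3 := hG.mul_left_cancel h2
  simpa using congrFun (congrFun h3 i) i

/-- Minkowski's theorem on linear forms. -/
theorem exists_int_ne_zero_forall_abs_mulVec_lt {d : ℕ} (M : Matrix (Fin d) (Fin d) ℝ)
    (hM : M.det ≠ 0) {R : ℝ} (hR : 0 < R) (hMR : |M.det| < R ^ d) :
    ∃ x : Fin d → ℤ, x ≠ 0 ∧ ∀ i, |(M *ᵥ (fun k => (x k : ℝ))) i| < R := by
  have hdet : LinearMap.det (Matrix.toLin' M) ≠ 0 := by rwa [LinearMap.det_toLin']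
  have hvol : MeasureTheory.volume (ZSpan.fundamentalDomain (Pi.basisFun ℝ (Fin d)))
      * 2 ^ Module.finrank ℝ (Fin d → ℝ)
      < MeasureTheory.volume ((Matrix.toLin' M) ⁻¹' Metric.ball 0 R) := by
    rw [MeasureTheory.Measure.addHaar_preimage_linearMap _ hdet, Real.volume_pi_ball _ hR,
      ZSpan.fundamentalDomain_pi_basisFun, MeasureTheory.volume_pi, MeasureTheory.Measure.pi_pi,
      LinearMap.det_toLin', ← ENNReal.ofReal_mul (abs_nonneg _)]
    simp only [Real.volume_Ico, sub_zero, ENNReal.ofReal_one, Finset.prod_const_one, one_mul,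
      Module.finrank_fin_fun, Fintype.card_fin]
    rw [← ENNReal.ofReal_ofNat, ← ENNReal.ofReal_pow (by norm_num)]
    refine (ENNReal.ofReal_lt_ofReal_iff_of_nonneg (by positivity)).2 ?_
    rw [abs_inv, mul_pow, mul_left_comm]
    have h1 : 1 < |M.det|⁻¹ * R ^ d := by
      rw [inv_mul_eq_div, one_lt_div (abs_pos.2 hM)]
      exact hMR
    have h2 : (0 : ℝ) < 2 ^ d := by positivity
    nlinarith
  have : Countable (Submodule.span ℤ (Set.range (Pi.basisFun ℝ (Fin d)))).toAddSubgroup :=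
    inferInstanceAs (Countable (Submodule.span ℤ (Set.range (Pi.basisFun ℝ (Fin d)))))
  obtain ⟨⟨y, hy⟩, hy0, hys⟩ :=
    MeasureTheory.exists_ne_zero_mem_lattice_of_measure_mul_two_pow_lt_measure
      (μ := MeasureTheory.volume)
      (L := (Submodule.span ℤ (Set.range (Pi.basisFun ℝ (Fin d)))).toAddSubgroup)
      (ZSpan.isAddFundamentalDomain' (Pi.basisFun ℝ (Fin d)) MeasureTheory.volume)
      (s := (Matrix.toLin' M) ⁻¹' Metric.ball 0 R)
      (fun x hx => by simpa [Matrix.mulVec_neg] using hx)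
      ((convex_ball _ _).linear_preimage _) hvol
  have hy' : ∀ i, ∃ n : ℤ, (n : ℝ) = y i := by
    have h1 := ((Pi.basisFun ℝ (Fin d)).mem_span_iff_repr_mem ℤ y).1 hy
    intro i
    simpa using h1 i
  choose x hx using hy'
  have hxy : (fun k => (x k : ℝ)) = y := funext hx
  refine ⟨x, ?_, ?_⟩
  · rintro rfl
    apply hy0
    ext i
    simp [← hx i]
  · intro i
    have h1 : ‖M *ᵥ y‖ < R := by simpa using hys
    rw [hxy, ← Real.norm_eq_abs]
    exact (norm_le_pi_norm _ i).trans_lt h1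

theorem exists_finite_subset_forall_exists_eq {α κ : Type*} (f : α → κ) (S : Set α)
    (h : (f '' S).Finite) : ∃ T ⊆ S, T.Finite ∧ ∀ x ∈ S, ∃ y ∈ T, f x = f y := by
  obtain ⟨T, hTS, hT⟩ := Set.exists_subset_bijOn S f
  refine ⟨T, hTS, Set.Finite.of_finite_image (hT.image_eq ▸ h) hT.injOn, fun x hx => ?_⟩
  obtain ⟨y, hy, hxy⟩ := hT.surjOn (Set.mem_image_of_mem f hx)
  exact ⟨y, hy, hxy.symm⟩

/-- Integer matrices with the same nonzero determinant that are congruent modulo a multiple of it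
differ by an element of `SL(d,ℤ)`. -/
theorem exists_specialLinearGroup_mul_eq {d : ℕ} {h h' : Matrix (Fin d) (Fin d) ℤ} {m : ℤ}
    (hdet : h.det = h'.det) (h0 : h'.det ≠ 0) (hm : h'.det ∣ m)
    (hmod : ∀ i j, m ∣ h i j - h' i j) :
    ∃ u : Matrix.SpecialLinearGroup (Fin d) ℤ, h = (u : Matrix (Fin d) (Fin d) ℤ) * h' := by
  have hX : ∀ i j, ∃ y, h i j - h' i j = h'.det * y := fun i j => hm.trans (hmod i j)
  choose X hX using hX
  have hX' : h = h' + h'.det • Matrix.of X := by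
    ext i j
    simp [← hX i j]
  have hu : h = (1 + Matrix.of X * h'.adjugate) * h' := by
    rw [add_mul, one_mul, mul_assoc, Matrix.adjugate_mul, Matrix.mul_smul, mul_one]
    exact hX'
  refine ⟨⟨1 + Matrix.of X * h'.adjugate, ?_⟩, hu⟩
  have h1 := congrArg Matrix.det hu
  rw [Matrix.det_mul, hdet] at h1
  exact (mul_eq_right₀ h0).1 h1.symm

/-- Integer matrices of bounded nonzero determinant form finitely many orbits under a finite-index
subgroup of `SL(d,ℤ)`. -/
theorem exists_finite_orbit_representatives {d : ℕ}
    (Γ : Subgroup (Matrix.SpecialLinearGroup (Fin d) ℤ)) [Γ.FiniteIndex]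
    (S : Set (Matrix (Fin d) (Fin d) ℤ)) (B : ℕ)
    (hS : ∀ h ∈ S, h.det ≠ 0 ∧ |h.det| ≤ B) :
    ∃ T ⊆ S, T.Finite ∧ ∀ h ∈ S, ∃ h' ∈ T, ∃ u ∈ Γ,
      h = (u : Matrix (Fin d) (Fin d) ℤ) * h' := by
  have : NeZero B.factorial := ⟨B.factorial_ne_zero⟩
  obtain ⟨T₁, -, hT₁, hT₁S⟩ := exists_finite_subset_forall_exists_eq
    (fun h : Matrix (Fin d) (Fin d) ℤ => (h.det, h.map (Int.cast : ℤ → ZMod B.factorial))) S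
    (Set.Finite.subset ((Set.finite_Icc (-(B : ℤ)) B).prod Set.finite_univ) (by
      rintro _ ⟨h, hh, rfl⟩
      exact ⟨abs_le.1 (hS h hh).2, Set.mem_univ _⟩))
  have key : ∀ h ∈ S, ∃ t ∈ T₁, ∃ u : Matrix.SpecialLinearGroup (Fin d) ℤ,
      h = (u : Matrix (Fin d) (Fin d) ℤ) * t := by
    intro h hh
    obtain ⟨t, ht, hht⟩ := hT₁S h hh
    simp only [Prod.mk.injEq] at hht
    refine ⟨t, ht, exists_specialLinearGroup_mul_eq (m := B.factorial) hht.1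
      (hht.1 ▸ (hS h hh).1) ?_ ?_⟩
    · rw [← hht.1, ← Int.natAbs_dvd_natAbs, Int.natAbs_natCast]
      refine Nat.dvd_factorial (Int.natAbs_pos.2 (hS h hh).1) ?_
      have := (hS h hh).2
      rw [Int.abs_eq_natAbs] at this
      exact_mod_cast this
    · intro i j
      have h1 := congrFun (congrFun hht.2 i) j
      simp only [Matrix.map_apply] at h1
      rw [← ZMod.intCast_zmod_eq_zero_iff_dvd]
      simp [h1]
  choose! t ht u hu using key
  obtain ⟨T, hTS, hT, hrep⟩ := exists_finite_subset_forall_exists_eq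
    (fun h => (t h, (QuotientGroup.mk (u h)⁻¹ : Matrix.SpecialLinearGroup (Fin d) ℤ ⧸ Γ))) S
    (Set.Finite.subset (hT₁.prod Set.finite_univ) (by
      rintro _ ⟨h, hh, rfl⟩
      exact ⟨ht h hh, Set.mem_univ _⟩))
  refine ⟨T, hTS, hT, fun h hh => ?_⟩
  obtain ⟨h', hh', he⟩ := hrep h hh
  simp only [Prod.mk.injEq, QuotientGroup.eq, inv_inv] at he
  refine ⟨h', hh', _, he.2, ?_⟩
  calc h = (u h : Matrix (Fin d) (Fin d) ℤ) * t h' := by rw [← he.1]; exact hu h hh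
    _ = ((u h * (u h')⁻¹ * u h' : Matrix.SpecialLinearGroup (Fin d) ℤ) :
          Matrix (Fin d) (Fin d) ℤ) * t h' := by rw [inv_mul_cancel_right]
    _ = _ := by rw [Matrix.SpecialLinearGroup.coe_mul, mul_assoc, ← hu h' (hTS hh')]

open Polynomial in
theorem aeval_ne_zero_of_degree_lt_of_irreducible {d : ℕ} {χ p : ℤ[X]} (hχ : χ.Monic)
    (hirr : Irreducible (χ.map (Int.castRingHom ℚ))) {x : ℝ} (hx : aeval x χ = 0) (hp : p ≠ 0)
    (hdeg : p.degree < d) (hχd : χ.degree = d) : aeval x p ≠ 0 := by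
  intro h
  have e : ∀ q : ℤ[X], aeval x (q.map (Int.castRingHom ℚ)) = aeval x q := fun q =>
    aeval_map_algebraMap ℚ x q
  have h1 := minpoly.eq_of_irreducible_of_monic hirr (by rw [e, hx]) (hχ.map _)
  have h2 : minpoly ℚ x ∣ p.map (Int.castRingHom ℚ) := minpoly.dvd ℚ x (by rw [e, h])
  rw [← h1] at h2
  have hinj : Function.Injective (Int.castRingHom ℚ) := Int.cast_injective
  have h3 := degree_le_of_dvd h2 ((Polynomial.map_ne_zero_iff hinj).2 hp)
  rw [degree_map_eq_of_injective hinj, degree_map_eq_of_injective hinj, hχd] at h3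
  exact absurd hdeg (not_lt.2 h3)

open Polynomial in
theorem exists_aeval_ne_zero_of_natDegree_lt {d : ℕ} {p : ℤ[X]} (hp : p ≠ 0)
    (hdeg : p.natDegree < d) {δ : Fin d → ℝ} (hδ : Function.Injective δ) :
    ∃ i, aeval (δ i) p ≠ 0 := by
  by_contra! h
  have hinj : Function.Injective (Int.castRingHom ℝ) := Int.cast_injective
  refine (Polynomial.map_ne_zero_iff hinj).2 hp
    (eq_zero_of_natDegree_lt_card_of_eval_eq_zero _ hδ (fun i => ?_) ?_)
  · rw [← h i, aeval_def, eval_map]; rfl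
  · rwa [Fintype.card_fin, natDegree_map_eq_of_injective hinj]

open Polynomial in
/-- A reducible monic integer polynomial of degree `d` with `d` given distinct real roots has an
integer factor vanishing at some but not all of these roots. -/
theorem exists_aeval_eq_zero_and_aeval_ne_zero {d : ℕ} (hd : d ≠ 0) {χ : ℤ[X]} (hχ : χ.Monic)
    (hχd : χ.natDegree = d) (hirr : ¬ Irreducible (χ.map (Int.castRingHom ℚ)))
    {δ : Fin d → ℝ} (hδ : Function.Injective δ) (hroot : ∀ i, aeval (δ i) χ = 0) :
    ∃ p : ℤ[X], (∃ i, aeval (δ i) p = 0) ∧ ∃ j, aeval (δ j) p ≠ 0 := by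
  have hirr' : ¬ Irreducible χ := fun h =>
    hirr ((hχ.irreducible_iff_irreducible_map_fraction_map (K := ℚ)).1 h)
  rw [hχ.irreducible_iff_natDegree'] at hirr'
  have h1 : χ ≠ 1 := by
    rintro rfl
    simp at hχd
    exact hd hχd.symm
  push Not at hirr'
  obtain ⟨p, q, hp, hq, hpq, hdq⟩ := hirr' h1
  have hadd : p.natDegree + q.natDegree = d := by rw [← hp.natDegree_mul hq, hpq, hχd]
  rw [Finset.mem_Ioc, hχd] at hdq
  obtain ⟨j, hj⟩ := exists_aeval_ne_zero_of_natDegree_lt hp.ne_zero (by omega) hδ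
  obtain ⟨i, hi⟩ := exists_aeval_ne_zero_of_natDegree_lt hq.ne_zero (by omega) hδ
  refine ⟨p, ⟨i, ?_⟩, j, hj⟩
  have := hroot i
  rw [← hpq, map_mul] at this
  exact (mul_eq_zero.1 this).resolve_right hi

theorem one_le_mul_pow_of_one_le_prod {d : ℕ} {z : Fin d → ℝ} {R : ℝ} (h0 : ∀ i, 0 ≤ z i)
    (hR : ∀ i, z i ≤ R) (h1 : 1 ≤ ∏ i, z i) (i : Fin d) : 1 ≤ z i * R ^ (d - 1) := by
  rw [← Finset.mul_prod_erase _ _ (Finset.mem_univ i)] at h1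
  refine h1.trans (mul_le_mul_of_nonneg_left ?_ (h0 i))
  have h2 : ∏ j ∈ Finset.univ.erase i, z j ≤ ∏ _j ∈ Finset.univ.erase i, R :=
    Finset.prod_le_prod (fun j _ => h0 j) (fun j _ => hR j)
  simpa using h2

/-- For every `b` with product one there is an invertible integer matrix diagonalised by `G` whose
eigenvalues are bounded by a uniform multiple of the entries of `b`. -/
theorem exists_commuting_int_matrix_abs_lt {d : ℕ} {M : Matrix (Fin d) (Fin d) ℤ}
    {G : Matrix (Fin d) (Fin d) ℝ} (hG : IsUnit G) {δ : Fin d → ℝ} (hδ : Function.Injective δ)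
    (h : M.map (Int.cast : ℤ → ℝ) * G = G * diagonal δ)
    (hirr : Irreducible (M.charpoly.map (Int.castRingHom ℚ))) :
    ∃ R : ℝ, 0 < R ∧ ∀ b : Fin d → ℝ, ∏ i, b i = 1 →
      ∃ (H : Matrix (Fin d) (Fin d) ℤ) (c : Fin d → ℝ), (∀ i, c i ≠ 0) ∧
        H.map (Int.cast : ℤ → ℝ) * G = G * diagonal c ∧ ∀ i, |c i| < R * |b i| := by
  have hV : (vandermonde δ).det ≠ 0 := det_vandermonde_ne_zero_iff.2 hδ
  rcases Nat.eq_zero_or_pos d with rfl | hd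
  · exact ⟨1, one_pos, fun b _ => ⟨1, 0, fun i => i.elim0, Subsingleton.elim _ _,
      fun i => i.elim0⟩⟩
  have hR1 : 1 ≤ |(vandermonde δ).det| + 1 := by linarith [abs_nonneg (vandermonde δ).det]
  refine ⟨|(vandermonde δ).det| + 1, by linarith, fun b hb => ?_⟩
  have hb0 : ∀ i, b i ≠ 0 := fun i => Finset.prod_ne_zero_iff.1 (hb ▸ one_ne_zero) i
    (Finset.mem_univ i)
  have hdet : (diagonal (fun i => (b i)⁻¹) * vandermonde δ).det = (vandermonde δ).det := by
    rw [det_mul, det_diagonal, Finset.prod_inv_distrib, hb, inv_one, one_mul]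
  obtain ⟨x, hx0, hx⟩ := exists_int_ne_zero_forall_abs_mulVec_lt
    (diagonal (fun i => (b i)⁻¹) * vandermonde δ) (by rwa [hdet])
    (R := |(vandermonde δ).det| + 1) (by linarith) (by
      rw [hdet]
      exact (lt_add_one _).trans_le (le_self_pow₀ hR1 hd.ne'))
  let p : Polynomial ℤ := ∑ k : Fin d, Polynomial.C (x k) * Polynomial.X ^ (k : ℕ)
  have hp : p ≠ 0 := by
    intro h0
    apply hx0
    ext k
    have h1 : p.coeff k = 0 := by rw [h0, Polynomial.coeff_zero]
    simpa [p, Polynomial.finsetSum_coeff, Polynomial.coeff_C_mul, Polynomial.coeff_X_pow,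
      Fin.val_inj] using h1
  have hval : ∀ i, Polynomial.aeval (δ i) p
      = b i * ((diagonal (fun i => (b i)⁻¹) * vandermonde δ) *ᵥ (fun k => (x k : ℝ))) i := by
    intro i
    rw [← mulVec_mulVec, mulVec_diagonal, mul_inv_cancel_left₀ (hb0 i)]
    simp [p, mulVec, dotProduct, vandermonde_apply, mul_comm]
  refine ⟨Polynomial.aeval M p, fun i => Polynomial.aeval (δ i) p, fun i => ?_,
    map_aeval_mul_eq_mul_diagonal h p, fun i => ?_⟩
  · refine aeval_ne_zero_of_degree_lt_of_irreducible M.charpoly_monic hirr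
      (aeval_charpoly_eq_zero_of_diagonalized hG h i) hp (Polynomial.degree_sum_fin_lt x) ?_
    rw [Matrix.charpoly_degree_eq_dim, Fintype.card_fin]
  · beta_reduce
    rw [hval, abs_mul, mul_comm]
    exact mul_lt_mul_of_pos_right (hx i) (abs_pos.2 (hb0 i))

theorem isCompact_setOf_mul_diagonal {d : ℕ} (G : Matrix (Fin d) (Fin d) ℝ)
    (K : ℝ) :
    IsCompact {x : Matrix.SpecialLinearGroup (Fin d) ℝ | ∃ b : Fin d → ℝ,
      (∀ i, |b i| ≤ K) ∧ (diagonal b).det = 1 ∧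
        (x : Matrix (Fin d) (Fin d) ℝ) = G * diagonal b} := by
  by_cases hG : G.det = 1
  · have hind : Topology.IsInducing
        (fun g : Matrix.SpecialLinearGroup (Fin d) ℝ => (g : Matrix (Fin d) (Fin d) ℝ)) := ⟨rfl⟩
    rw [hind.isCompact_iff]
    have hcpt : IsCompact {b : Fin d → ℝ | (∀ i, |b i| ≤ K) ∧ (diagonal b).det = 1} := by
      refine (isCompact_univ_pi (fun _ : Fin d => isCompact_Icc (a := -K) (b := K))).inter_right
        (t := {b : Fin d → ℝ | (diagonal b).det = 1}) ?_ |>.of_isClosed_subset ?_ ?_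
      · exact isClosed_eq (by fun_prop) continuous_const
      · simp only [Set.ofPred_and, Set.ofPred_forall]
        exact (isClosed_iInter fun i => isClosed_le (by fun_prop) continuous_const).inter
          (isClosed_eq (by fun_prop) continuous_const)
      · rintro b ⟨h1, h2⟩
        exact ⟨fun i _ => abs_le.1 (h1 i), h2⟩
    convert hcpt.image (f := fun b => G * diagonal b) (by fun_prop) using 1
    ext m
    constructor
    · rintro ⟨x, ⟨b, h1, h2, h3⟩, rfl⟩
      exact ⟨b, ⟨h1, h2⟩, h3.symm⟩
    · rintro ⟨b, ⟨h1, h2⟩, rfl⟩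
      exact ⟨⟨G * diagonal b, by rw [det_mul, hG, h2, one_mul]⟩, ⟨b, h1, h2, rfl⟩, rfl⟩
  · convert isCompact_empty
    ext x
    simp only [Set.mem_ofPred_eq, Set.mem_empty_iff_false, iff_false]
    rintro ⟨b, -, h2, h3⟩
    have h4 := congrArg Matrix.det h3
    rw [det_mul, h2, mul_one, x.2] at h4
    exact hG h4.symm

theorem coe_toSLR {d : ℕ} (u : Matrix.SpecialLinearGroup (Fin d) ℤ) :
    (toSLR u : Matrix (Fin d) (Fin d) ℝ)
      = (u : Matrix (Fin d) (Fin d) ℤ).map (Int.cast : ℤ → ℝ) := rfl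

/-- If the characteristic polynomial is irreducible, the orbit is the image of a compact subset of
`g·AM`. -/
theorem isCompact_image_orbit_of_irreducible {d : ℕ}
    (Γ : Subgroup (Matrix.SpecialLinearGroup (Fin d) ℤ)) [Γ.FiniteIndex]
    {M : Matrix (Fin d) (Fin d) ℤ} (g : Matrix.SpecialLinearGroup (Fin d) ℝ) {δ : Fin d → ℝ}
    (hδ : Function.Injective δ)
    (h : M.map (Int.cast : ℤ → ℝ) * (g : Matrix (Fin d) (Fin d) ℝ)
      = (g : Matrix (Fin d) (Fin d) ℝ) * diagonal δ)
    (hirr : Irreducible (M.charpoly.map (Int.castRingHom ℚ))) :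
    IsCompact
      (Quotient.mk (QuotientGroup.rightRel (Γ.map toSLR)) ''
        {x : Matrix.SpecialLinearGroup (Fin d) ℝ | ∃ b : Fin d → ℝ,
          (Matrix.diagonal b).det = 1 ∧
          (x : Matrix (Fin d) (Fin d) ℝ)
            = (g : Matrix (Fin d) (Fin d) ℝ) * Matrix.diagonal b}) := by
  set G : Matrix (Fin d) (Fin d) ℝ := (g : Matrix (Fin d) (Fin d) ℝ) with hGdef
  have hGdet : G.det = 1 := g.2
  have hG : IsUnit G := (isUnit_iff_isUnit_det _).2 (by rw [hGdet]; exact isUnit_one)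
  obtain ⟨R, hR, hH⟩ := exists_commuting_int_matrix_abs_lt hG hδ h hirr
  obtain ⟨B, hB⟩ := exists_nat_ge (R ^ d)
  have hdet : ∀ (H : Matrix (Fin d) (Fin d) ℤ) (c : Fin d → ℝ),
      H.map (Int.cast : ℤ → ℝ) * G = G * diagonal c → (H.det : ℝ) = ∏ i, c i := by
    intro H c hc
    have h1 := congrArg Matrix.det hc
    rw [det_mul, det_mul, hGdet, mul_one, one_mul, det_diagonal] at h1
    rw [← h1]
    exact (Int.castRingHom ℝ).map_det H
  let S : Set (Matrix (Fin d) (Fin d) ℤ) := {H | (H.det ≠ 0 ∧ |H.det| ≤ B) ∧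
    ∃ c : Fin d → ℝ, H.map (Int.cast : ℤ → ℝ) * G = G * diagonal c}
  obtain ⟨T, hTS, hT, hrep⟩ := exists_finite_orbit_representatives Γ S B (fun H hH => hH.1)
  have hc : ∀ H ∈ T, ∃ c : Fin d → ℝ, H.map (Int.cast : ℤ → ℝ) * G = G * diagonal c :=
    fun H hH => (hTS hH).2
  choose! c hc using hc
  obtain ⟨K, hK⟩ := (hT.image fun H => ‖c H‖).bddAbove
  have hK' : ∀ H ∈ T, ∀ i, |c H i| ≤ K := fun H hH i =>
    (norm_le_pi_norm (c H) i).trans (hK (Set.mem_image_of_mem _ hH))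
  convert (isCompact_setOf_mul_diagonal G (K * R ^ (d - 1))).image
    (f := Quotient.mk (QuotientGroup.rightRel (Γ.map toSLR))) continuous_quotient_mk' using 1
  refine Set.Subset.antisymm ?_ (Set.image_mono ?_)
  swap
  · rintro x ⟨b, -, h2, h3⟩
    exact ⟨b, h2, h3⟩
  rintro _ ⟨x, ⟨b, hb, hx⟩, rfl⟩
  have hb' : ∏ i, b i = 1 := by rwa [det_diagonal] at hb
  obtain ⟨H, a, ha0, haG, hab⟩ := hH b hb'
  have habs : |(H.det : ℝ)| = ∏ i, |a i| := by rw [hdet H a haG, Finset.abs_prod]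
  have hbabs : ∏ i, |b i| = 1 := by rw [← Finset.abs_prod, hb', abs_one]
  have hHdet : H.det ≠ 0 := by
    have : (H.det : ℝ) ≠ 0 := by
      rw [hdet H a haG]
      exact Finset.prod_ne_zero_iff.2 fun i _ => ha0 i
    exact_mod_cast this
  have hb0 : ∀ i, b i ≠ 0 := fun i => Finset.prod_ne_zero_iff.1 (hb' ▸ one_ne_zero) i
    (Finset.mem_univ i)
  have hHS : H ∈ S := by
    refine ⟨⟨hHdet, ?_⟩, a, haG⟩
    have h1 : |(H.det : ℝ)| ≤ B := by
      calc |(H.det : ℝ)| = ∏ i, |a i| := habs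
        _ ≤ ∏ i, (R * |b i|) := Finset.prod_le_prod (fun i _ => abs_nonneg _)
            (fun i _ => (hab i).le)
        _ = R ^ d := by rw [Finset.prod_mul_distrib, hbabs]; simp
        _ ≤ B := hB
    exact_mod_cast h1
  obtain ⟨H', hH'T, u, hu, hHu⟩ := hrep H hHS
  have hlow : ∀ i, |b i| ≤ |a i| * R ^ (d - 1) := by
    intro i
    have h1 := one_le_mul_pow_of_one_le_prod (z := fun i => |a i| / |b i|) (R := R)
      (fun i => by positivity)
      (fun i => (div_le_iff₀ (abs_pos.2 (hb0 i))).2 (hab i).le)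
      (by
        rw [Finset.prod_div_distrib, hbabs, div_one, ← habs]
        exact_mod_cast Int.one_le_abs hHdet) i
    rw [div_mul_eq_mul_div, one_le_div (abs_pos.2 (hb0 i))] at h1
    exact h1
  let e : Fin d → ℝ := fun i => c H' i * (b i / a i)
  have hue : (toSLR u : Matrix (Fin d) (Fin d) ℝ) * (G * diagonal e) = G * diagonal b := by
    have h1 : H.map (Int.cast : ℤ → ℝ)
        = (toSLR u : Matrix (Fin d) (Fin d) ℝ) * H'.map (Int.cast : ℤ → ℝ) := by
      rw [hHu, coe_toSLR]
      exact Matrix.map_mul (f := Int.castRingHom ℝ)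
    have h2 : diagonal e = diagonal (c H') * diagonal (fun i => b i / a i) := by
      rw [diagonal_mul_diagonal]
    rw [h2, ← mul_assoc G, ← hc H' hH'T, ← mul_assoc, ← mul_assoc, ← h1, haG, mul_assoc,
      diagonal_mul_diagonal]
    congr 2
    ext i
    exact mul_div_cancel₀ _ (ha0 i)
  have hedet : (diagonal e).det = 1 := by
    have h1 := congrArg Matrix.det hue
    rw [det_mul, det_mul, det_mul, hGdet, hb, (toSLR u).2] at h1
    simpa using h1
  let y : Matrix.SpecialLinearGroup (Fin d) ℝ :=
    ⟨G * diagonal e, by rw [det_mul, hGdet, hedet, one_mul]⟩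
  refine ⟨y, ⟨e, fun i => ?_, hedet, rfl⟩,
    Quotient.sound ?_⟩
  · have h1 : |b i / a i| ≤ R ^ (d - 1) := by
      rw [abs_div, div_le_iff₀ (abs_pos.2 (ha0 i)), mul_comm]
      exact hlow i
    calc |e i| = |c H' i| * |b i / a i| := abs_mul _ _
      _ ≤ K * R ^ (d - 1) := mul_le_mul (hK' H' hH'T i) h1 (abs_nonneg _)
          ((abs_nonneg _).trans (hK' H' hH'T i))
  · refine QuotientGroup.rightRel_apply.2 ⟨u, hu, ?_⟩
    exact eq_mul_inv_of_mul_eq (Subtype.ext (hue.trans hx.symm))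

/-- On a subset of `SL(d,ℝ)` with relatively compact image in `Γ\SL(d,ℝ)`, every point can be moved
by `Γ` so that its inverse has uniformly bounded entries. -/
theorem exists_bound_adjugate_of_isCompact_image {d : ℕ}
    (Λ : Subgroup (Matrix.SpecialLinearGroup (Fin d) ℝ))
    {F : Set (Matrix.SpecialLinearGroup (Fin d) ℝ)}
    (hF : IsCompact (Quotient.mk (QuotientGroup.rightRel Λ) '' F)) :
    ∃ n : ℕ, ∀ x ∈ F, ∃ u ∈ Λ, ∀ i j,
      |((u * x : Matrix.SpecialLinearGroup (Fin d) ℝ) :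
        Matrix (Fin d) (Fin d) ℝ).adjugate i j| < n := by
  let W : ℕ → Set (Matrix.SpecialLinearGroup (Fin d) ℝ) := fun n =>
    {x | ∀ i j, |(x : Matrix (Fin d) (Fin d) ℝ).adjugate i j| < n}
  have hcoe : Continuous
      (fun g : Matrix.SpecialLinearGroup (Fin d) ℝ => (g : Matrix (Fin d) (Fin d) ℝ)) :=
    continuous_induced_dom
  have hW : ∀ n, IsOpen (Quotient.mk (QuotientGroup.rightRel Λ) '' W n) := by
    intro n
    refine isOpen_coinduced.2 ?_
    have h1 : Quotient.mk (QuotientGroup.rightRel Λ) ⁻¹'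
        (Quotient.mk (QuotientGroup.rightRel Λ) '' W n) = ⋃ u ∈ Λ, {x | u * x ∈ W n} := by
      ext x
      simp only [Set.mem_preimage, Set.mem_image, Set.mem_iUnion, Set.mem_ofPred_eq, exists_prop]
      constructor
      · rintro ⟨y, hy, hyx⟩
        have h2 := QuotientGroup.rightRel_apply.1 (Quotient.exact hyx.symm)
        exact ⟨_, h2, by rwa [inv_mul_cancel_right]⟩
      · rintro ⟨u, hu, hux⟩
        refine ⟨_, hux, Quotient.sound (QuotientGroup.rightRel_apply.2 ?_)⟩
        rw [_root_.mul_inv_rev, mul_inv_cancel_left]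
        exact inv_mem hu
    refine h1 ▸ isOpen_biUnion fun u _ => ?_
    have h2 : {x | u * x ∈ W n} = ⋂ (i : Fin d) (j : Fin d),
        {x : Matrix.SpecialLinearGroup (Fin d) ℝ | |((u : Matrix (Fin d) (Fin d) ℝ)
          * (x : Matrix (Fin d) (Fin d) ℝ)).adjugate i j| < n} := by
      ext x
      simp [W]
    rw [h2]
    exact isOpen_iInter_of_finite fun i => isOpen_iInter_of_finite fun j =>
      isOpen_lt ((continuous_const.matrix_mul hcoe).matrix_adjugate.matrix_elem i j).abs
        continuous_const
  obtain ⟨n, hn⟩ := hF.elim_directed_cover _ hW (by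
    rintro _ ⟨x, -, rfl⟩
    obtain ⟨n, hn⟩ := exists_nat_gt ‖fun i j => (x : Matrix (Fin d) (Fin d) ℝ).adjugate i j‖
    refine Set.mem_iUnion.2 ⟨n, x, fun i j => ?_, rfl⟩
    exact ((norm_le_pi_norm _ j).trans (norm_le_pi_norm
      (fun i j => (x : Matrix (Fin d) (Fin d) ℝ).adjugate i j) i)).trans_lt hn)
    (directed_of_isDirected_le fun m n hmn => Set.image_mono fun x hx i j =>
      (hx i j).trans_le (by exact_mod_cast hmn))
  refine ⟨n, fun x hx => ?_⟩
  obtain ⟨y, hy, hyx⟩ := hn (Set.mem_image_of_mem _ hx)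
  have h2 := QuotientGroup.rightRel_apply.1 (Quotient.exact hyx.symm)
  exact ⟨_, h2, by rwa [inv_mul_cancel_right]⟩

/-- A nonzero integer matrix whose product with `g` has a vanishing column forces the orbit of `g`
to leave every compact set. -/
theorem not_isCompact_image_orbit {d : ℕ}
    (Γ : Subgroup (Matrix.SpecialLinearGroup (Fin d) ℤ))
    (g : Matrix.SpecialLinearGroup (Fin d) ℝ) {P : Matrix (Fin d) (Fin d) ℤ} (hP : P ≠ 0)
    {i₀ : Fin d} (hi₀ : ∀ i, (P.map (Int.cast : ℤ → ℝ) * (g : Matrix (Fin d) (Fin d) ℝ)) i i₀ = 0) :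
    ¬ IsCompact
      (Quotient.mk (QuotientGroup.rightRel (Γ.map toSLR)) ''
        {x : Matrix.SpecialLinearGroup (Fin d) ℝ | ∃ b : Fin d → ℝ,
          (Matrix.diagonal b).det = 1 ∧
          (x : Matrix (Fin d) (Fin d) ℝ)
            = (g : Matrix (Fin d) (Fin d) ℝ) * Matrix.diagonal b}) := by
  intro hF
  obtain ⟨n, hn⟩ := exists_bound_adjugate_of_isCompact_image _ hF
  set G : Matrix (Fin d) (Fin d) ℝ := (g : Matrix (Fin d) (Fin d) ℝ) with hGdef
  set A : Matrix (Fin d) (Fin d) ℝ := P.map (Int.cast : ℤ → ℝ) * G with hA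
  obtain ⟨C, hC⟩ : ∃ C : ℝ, ∀ i j, |A i j| ≤ C :=
    ⟨‖fun i j => A i j‖, fun i j => (norm_le_pi_norm _ j).trans
      (norm_le_pi_norm (fun i j => A i j) i)⟩
  have hC0 : 0 ≤ C := (abs_nonneg _).trans (hC i₀ i₀)
  set t : ℝ := (d * C * n + 1)⁻¹ with ht
  have htpos : 0 < t := by positivity
  let b : Fin d → ℝ := fun i => if i = i₀ then (t ^ (d - 1))⁻¹ else t
  have hb : (diagonal b).det = 1 := by
    rw [det_diagonal, ← Finset.mul_prod_erase _ _ (Finset.mem_univ i₀)]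
    have h1 : ∏ j ∈ Finset.univ.erase i₀, b j = t ^ (d - 1) := by
      rw [Finset.prod_congr rfl (g := fun _ => t)
        (fun j hj => if_neg (Finset.ne_of_mem_erase hj))]
      simp
    rw [h1]
    simp only [b, if_true]
    exact inv_mul_cancel₀ (by positivity)
  let x : Matrix.SpecialLinearGroup (Fin d) ℝ :=
    ⟨G * diagonal b, by rw [det_mul, hb, mul_one]; exact g.2⟩
  obtain ⟨_, ⟨u, hu, rfl⟩, hux⟩ := hn x ⟨b, hb, rfl⟩
  have hAb : ∀ i j, |(A * diagonal b) i j| ≤ C * t := by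
    intro i j
    rw [mul_diagonal]
    by_cases hj : j = i₀
    · rw [hj, hi₀, zero_mul, abs_zero]
      positivity
    · simp only [b, if_neg hj]
      rw [abs_mul, abs_of_pos htpos]
      exact mul_le_mul_of_nonneg_right (hC i j) htpos.le
  let Q : Matrix (Fin d) (Fin d) ℤ := P * ((u⁻¹ : Matrix.SpecialLinearGroup (Fin d) ℤ) :
    Matrix (Fin d) (Fin d) ℤ)
  have hQ : Q.map (Int.cast : ℤ → ℝ)
      = (A * diagonal b) * ((toSLR u * x : Matrix.SpecialLinearGroup (Fin d) ℝ) :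
        Matrix (Fin d) (Fin d) ℝ).adjugate := by
    have h1 : Q.map (Int.cast : ℤ → ℝ)
        = P.map (Int.cast : ℤ → ℝ) * (toSLR u⁻¹ : Matrix (Fin d) (Fin d) ℝ) :=
      Matrix.map_mul (f := Int.castRingHom ℝ)
    have h2 : A * diagonal b = P.map (Int.cast : ℤ → ℝ) * (x : Matrix (Fin d) (Fin d) ℝ) :=
      mul_assoc _ _ _
    rw [h1, h2, ← Matrix.SpecialLinearGroup.coe_inv, mul_assoc,
      ← Matrix.SpecialLinearGroup.coe_mul, _root_.mul_inv_rev, mul_inv_cancel_left, map_inv]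
  have hQ0 : Q = 0 := by
    ext i j
    have h1 : |(Q i j : ℝ)| < 1 := by
      have h2 : (Q i j : ℝ) = Q.map (Int.cast : ℤ → ℝ) i j := rfl
      rw [h2, hQ, mul_apply]
      calc _ ≤ ∑ k, |(A * diagonal b) i k * ((toSLR u * x :
              Matrix.SpecialLinearGroup (Fin d) ℝ) :
              Matrix (Fin d) (Fin d) ℝ).adjugate k j| := Finset.abs_sum_le_sum_abs _ _
        _ ≤ ∑ _k : Fin d, C * t * n := Finset.sum_le_sum fun k _ => by
            rw [abs_mul]
            exact mul_le_mul (hAb i k) (hux k j).le (abs_nonneg _) (by positivity)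
        _ = (d * C * n) * (d * C * n + 1)⁻¹ := by
            rw [Finset.sum_const, Finset.card_univ, Fintype.card_fin, nsmul_eq_mul, ← ht]
            ring
        _ < 1 := by
            rw [← div_eq_mul_inv, div_lt_one (by positivity)]
            exact lt_add_one _
    have h3 : |Q i j| < 1 := by exact_mod_cast h1
    simpa using Int.abs_lt_one_iff.1 h3
  apply hP
  have h1 : P = Q * (u : Matrix (Fin d) (Fin d) ℤ) := by
    simp only [Q]
    rw [mul_assoc, ← Matrix.SpecialLinearGroup.coe_mul, inv_mul_cancel,
      Matrix.SpecialLinearGroup.coe_one, mul_one]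
  rw [h1, hQ0, zero_mul]

theorem stmt3 (d : ℕ) (hd : 2 ≤ d)
    (Γ : Subgroup (Matrix.SpecialLinearGroup (Fin d) ℤ)) (hΓ : Γ.FiniteIndex)
    (γ : Matrix.SpecialLinearGroup (Fin d) ℤ) (hγΓ : γ ∈ Γ)
    (g : Matrix.SpecialLinearGroup (Fin d) ℝ) (δ : Fin d → ℝ)
    (hδ : ∀ i j : Fin d, i ≠ j → |δ i| ≠ |δ j|)
    (hlox : ((γ : Matrix (Fin d) (Fin d) ℤ)).map (Int.cast : ℤ → ℝ)
      = (g : Matrix (Fin d) (Fin d) ℝ) * Matrix.diagonal δ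
        * ((g⁻¹ : Matrix.SpecialLinearGroup (Fin d) ℝ) : Matrix (Fin d) (Fin d) ℝ)) :
    IsCompact
      (Quotient.mk (QuotientGroup.rightRel (Γ.map toSLR)) ''
        {x : Matrix.SpecialLinearGroup (Fin d) ℝ | ∃ b : Fin d → ℝ,
          (Matrix.diagonal b).det = 1 ∧
          (x : Matrix (Fin d) (Fin d) ℝ)
            = (g : Matrix (Fin d) (Fin d) ℝ) * Matrix.diagonal b})
    ↔ Irreducible ((γ : Matrix (Fin d) (Fin d) ℤ).charpoly.map (Int.castRingHom ℚ)) := by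
  have hinj : Function.Injective δ := fun i j hij => by
    by_contra hne
    exact hδ i j hne (by rw [hij])
  have hdiag : ((γ : Matrix (Fin d) (Fin d) ℤ)).map (Int.cast : ℤ → ℝ)
      * (g : Matrix (Fin d) (Fin d) ℝ) = (g : Matrix (Fin d) (Fin d) ℝ) * Matrix.diagonal δ := by
    rw [hlox, mul_assoc, ← Matrix.SpecialLinearGroup.coe_mul, inv_mul_cancel,
      Matrix.SpecialLinearGroup.coe_one, mul_one]
  have hG : IsUnit (g : Matrix (Fin d) (Fin d) ℝ) :=
    (isUnit_iff_isUnit_det _).2 (by rw [g.2]; exact isUnit_one)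
  refine ⟨fun hF => ?_, isCompact_image_orbit_of_irreducible Γ g hinj hdiag⟩
  by_contra hirr
  obtain ⟨p, ⟨i, hi⟩, j, hj⟩ := exists_aeval_eq_zero_and_aeval_ne_zero (by omega)
    (γ : Matrix (Fin d) (Fin d) ℤ).charpoly_monic
    (by rw [Matrix.charpoly_natDegree_eq_dim, Fintype.card_fin]) hirr hinj
    (aeval_charpoly_eq_zero_of_diagonalized hG hdiag)
  have hp := map_aeval_mul_eq_mul_diagonal hdiag p
  refine not_isCompact_image_orbit Γ g
    (P := Polynomial.aeval (γ : Matrix (Fin d) (Fin d) ℤ) p) ?_ (i₀ := i) ?_ hF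
  · intro h0
    have h1 : (g : Matrix (Fin d) (Fin d) ℝ) * diagonal (fun i => Polynomial.aeval (δ i) p)
        = (g : Matrix (Fin d) (Fin d) ℝ) * 0 := by
      rw [← hp, h0]; simp
    have h2 := congrFun (congrFun (hG.mul_left_cancel h1) j) j
    exact hj (by simpa using h2)
  · intro k
    rw [hp, mul_diagonal, hi, mul_zero]
end

section
/- Let d ≥ 1, let γ ∈ SL(d,ℤ), let g ∈ SL(d,ℝ), and let a be a real diagonal matrix with pairwise distinct diagonal entries a_1,…,a_d such that γ·g = g·a. Let v ∈ ℤ^d and set x := v·g (a row vector). If every coordinate x_j of x is nonzero, then |x_1·x_2⋯x_d| · ∏_{1≤i<j≤d} |a_j − a_i| ≥ 1. -/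
open Matrix

lemma vecMul_pow_of_mul_eq_mul_diagonal {n R : Type*} [Fintype n] [DecidableEq n] [CommRing R]
    {A g : Matrix n n R} {a : n → R} (h : A * g = g * diagonal a) (w : n → R) (k : ℕ) (j : n) :
    (w ᵥ* A ^ k ᵥ* g) j = (w ᵥ* g) j * a j ^ k := by
  have hk : A ^ k * g = g * diagonal a ^ k :=
    (SemiconjBy.pow_right (a := g) (x := diagonal a) (y := A) h.symm k).symm
  rw [vecMul_vecMul, hk, diagonal_pow, ← vecMul_vecMul, vecMul_diagonal, Pi.pow_apply]

theorem stmt4 (d : ℕ) (hd : 1 ≤ d)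
    (γ : Matrix (Fin d) (Fin d) ℤ) (hγdet : γ.det = 1)
    (g : Matrix (Fin d) (Fin d) ℝ) (hgdet : g.det = 1)
    (a : Fin d → ℝ) (ha : Function.Injective a)
    (hconj : γ.map (Int.cast : ℤ → ℝ) * g = g * Matrix.diagonal a)
    (v : Fin d → ℤ)
    (hx : ∀ j, ((fun i => (v i : ℝ)) ᵥ* g) j ≠ 0) :
    1 ≤ |∏ j, ((fun i => (v i : ℝ)) ᵥ* g) j| *
      ∏ i : Fin d, ∏ j ∈ Finset.Ioi i, |a j - a i| := by
  set x := (fun i => (v i : ℝ)) ᵥ* g with hxdef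
  let W : Matrix (Fin d) (Fin d) ℤ := Matrix.of fun k => v ᵥ* γ ^ (k : ℕ)
  have hW : W.map (Int.cast : ℤ → ℝ) * g = (vandermonde a)ᵀ * diagonal x := by
    ext k j
    have hrow : (W.map (Int.cast : ℤ → ℝ)) k =
        (fun i => (v i : ℝ)) ᵥ* (γ.map (Int.cast : ℤ → ℝ)) ^ (k : ℕ) := by
      ext i
      have hpow : (γ ^ (k : ℕ)).map (Int.cast : ℤ → ℝ) = γ.map (Int.cast : ℤ → ℝ) ^ (k : ℕ) :=
        map_pow (Int.castRingHom ℝ).mapMatrix γ k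
      rw [← hpow]
      simp [W, vecMul, dotProduct]
    rw [mul_apply_eq_vecMul, hrow, vecMul_pow_of_mul_eq_mul_diagonal hconj, mul_diagonal,
      transpose_apply, vandermonde_apply, mul_comm]
  have hdet : (W.det : ℝ) = (vandermonde a).det * ∏ j, x j := by
    have h := congrArg Matrix.det hW
    rw [det_mul, det_mul, hgdet, mul_one, det_transpose, det_diagonal] at h
    rw [← h, Int.cast_det]
  have hne : W.det ≠ 0 := by
    intro h
    rw [h, Int.cast_zero] at hdet
    exact mul_ne_zero (det_vandermonde_ne_zero_iff.mpr ha)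
      (Finset.prod_ne_zero_iff.mpr fun j _ => hx j) hdet.symm
  have habs : |(W.det : ℝ)| = |∏ j, x j| * ∏ i : Fin d, ∏ j ∈ Finset.Ioi i, |a j - a i| := by
    rw [hdet, abs_mul, det_vandermonde, mul_comm]
    simp only [Finset.abs_prod]
  rw [← habs]
  exact_mod_cast Int.one_le_abs hne
end

section
/- Let d ≥ 1, let γ ∈ SL(d,ℤ), let g ∈ SL(d,ℝ), and let a be a real diagonal matrix with pairwise distinct diagonal entries a_1,…,a_d such that γ·g = g·a. Let v ∈ ℤ^d be such that every coordinate of the row vector x := v·g is nonzero. Then for every diagonal matrix b with positive diagonal entries and det b = 1 one has ‖v·g·b‖ ≥ (∏_{1≤i<j≤d} |a_j − a_i|)^{−1/d}, where ‖·‖ is the Euclidean norm on ℝ^d. -/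
open Matrix

/-- Each coordinate of a vector is bounded by its Euclidean norm. -/
lemma abs_le_euclNorm {d : ℕ} (y : Fin d → ℝ) (i : Fin d) : |y i| ≤ euclNorm y :=
  Real.abs_le_sqrt (Finset.single_le_sum (f := fun i => y i ^ 2)
    (fun _ _ => sq_nonneg _) (Finset.mem_univ i))

/-- The product of the coordinates of a vector is at most the `d`-th power of its norm. -/
lemma prod_abs_le_euclNorm_pow {d : ℕ} (y : Fin d → ℝ) : ∏ i, |y i| ≤ euclNorm y ^ d := by
  simpa using Finset.prod_le_prod (s := Finset.univ) (fun i _ => abs_nonneg (y i))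
    (fun i _ => abs_le_euclNorm y i)

/-- Powers of `A` act on `w ᵥ* g` coordinatewise if `g` diagonalizes `A`. -/
lemma vecMul_pow_vecMul_of_mul_eq_mul_diagonal {n R : Type*} [Fintype n] [DecidableEq n]
    [CommRing R] {A g : Matrix n n R} {a : n → R} (h : A * g = g * diagonal a)
    (w : n → R) (k : ℕ) (j : n) : ((w ᵥ* A ^ k) ᵥ* g) j = (w ᵥ* g) j * a j ^ k := by
  have hk : A ^ k * g = g * diagonal a ^ k :=
    (SemiconjBy.pow_right (show SemiconjBy g (diagonal a) A from h.symm) k).symm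
  rw [vecMul_vecMul, hk, diagonal_pow, ← vecMul_vecMul, vecMul_diagonal, Pi.pow_apply]

/-- The determinant of the matrix with rows `w, wA, …, wA^(d-1)`, when `g` diagonalizes `A`. -/
lemma det_krylov_mul_det {d : ℕ} {R : Type*} [CommRing R] {A g : Matrix (Fin d) (Fin d) R}
    {a : Fin d → R} (h : A * g = g * diagonal a) (w : Fin d → R) :
    (Matrix.of fun i : Fin d => w ᵥ* A ^ (i : ℕ)).det * g.det =
      (∏ i, ∏ j ∈ Finset.Ioi i, (a j - a i)) * ∏ j, (w ᵥ* g) j := by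
  have hprod : (Matrix.of fun i : Fin d => w ᵥ* A ^ (i : ℕ)) * g =
      (vandermonde a)ᵀ * diagonal (w ᵥ* g) := by
    ext i j
    rw [mul_diagonal, transpose_apply, vandermonde_apply, mul_comm,
      ← vecMul_pow_vecMul_of_mul_eq_mul_diagonal h]
    rfl
  rw [← det_mul, hprod, det_mul, det_transpose, det_vandermonde, det_diagonal]

/-- If an integer matrix is diagonalized by a unimodular `g` with distinct eigenvalues, then the
product of the coordinates of `v ᵥ* g`, for integral `v`, is zero or bounded below. -/
lemma one_le_prod_abs_sub_mul_prod_abs_vecMul {d : ℕ} {γ : Matrix (Fin d) (Fin d) ℤ}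
    {g : Matrix (Fin d) (Fin d) ℝ} (hgdet : g.det = 1) {a : Fin d → ℝ}
    (ha : Function.Injective a)
    (hconj : γ.map (Int.cast : ℤ → ℝ) * g = g * Matrix.diagonal a)
    {v : Fin d → ℤ} (hx : ∀ j, ((fun i => (v i : ℝ)) ᵥ* g) j ≠ 0) :
    1 ≤ (∏ i : Fin d, ∏ j ∈ Finset.Ioi i, |a j - a i|) *
      ∏ j, |((fun i => (v i : ℝ)) ᵥ* g) j| := by
  have hdet := det_krylov_mul_det hconj (fun i => (v i : ℝ))
  have hcast : (Matrix.of fun i : Fin d =>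
      (fun i => (v i : ℝ)) ᵥ* γ.map (Int.cast : ℤ → ℝ) ^ (i : ℕ)) =
      (Matrix.of fun i : Fin d => v ᵥ* γ ^ (i : ℕ)).map (Int.castRingHom ℝ) := by
    ext i j
    have hpow : γ.map (Int.cast : ℤ → ℝ) ^ (i : ℕ) =
        (γ ^ (i : ℕ)).map (Int.castRingHom ℝ) :=
      (map_pow (Int.castRingHom ℝ).mapMatrix γ i).symm
    rw [of_apply, hpow]
    exact (RingHom.map_vecMul (Int.castRingHom ℝ) (γ ^ (i : ℕ)) v j).symm
  rw [hgdet, mul_one, hcast, ← RingHom.mapMatrix_apply, ← RingHom.map_det, eq_intCast] at hdet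
  simp_rw [← Finset.abs_prod, ← abs_mul]
  rw [← hdet]
  have hne : (∏ i, ∏ j ∈ Finset.Ioi i, (a j - a i)) *
      ∏ j, ((fun i => (v i : ℝ)) ᵥ* g) j ≠ 0 := by
    rw [← det_vandermonde]
    exact mul_ne_zero (det_vandermonde_ne_zero_iff.mpr ha)
      (Finset.prod_ne_zero_iff.mpr fun j _ => hx j)
  rw [← hdet, Int.cast_ne_zero] at hne
  exact_mod_cast Int.one_le_abs hne

theorem stmt5 (d : ℕ) (hd : 1 ≤ d)
    (γ : Matrix (Fin d) (Fin d) ℤ) (hγdet : γ.det = 1)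
    (g : Matrix (Fin d) (Fin d) ℝ) (hgdet : g.det = 1)
    (a : Fin d → ℝ) (ha : Function.Injective a)
    (hconj : γ.map (Int.cast : ℤ → ℝ) * g = g * Matrix.diagonal a)
    (v : Fin d → ℤ)
    (hx : ∀ j, ((fun i => (v i : ℝ)) ᵥ* g) j ≠ 0) :
    ∀ b : Fin d → ℝ, (∀ i, 0 < b i) → (∏ i, b i) = 1 →
      (∏ i : Fin d, ∏ j ∈ Finset.Ioi i, |a j - a i|) ^ (-(1 : ℝ) / d)
        ≤ euclNorm ((fun i => (v i : ℝ)) ᵥ* (g * Matrix.diagonal b)) := by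
  intro b hb hb1
  have hlower := one_le_prod_abs_sub_mul_prod_abs_vecMul hgdet ha hconj hx
  have hupper := prod_abs_le_euclNorm_pow ((fun i => (v i : ℝ)) ᵥ* (g * Matrix.diagonal b))
  have hscale : ∏ j, |((fun i => (v i : ℝ)) ᵥ* (g * Matrix.diagonal b)) j| =
      ∏ j, |((fun i => (v i : ℝ)) ᵥ* g) j| := by
    simp_rw [← vecMul_vecMul, vecMul_diagonal, abs_mul, fun j => abs_of_pos (hb j)]
    rw [Finset.prod_mul_distrib, hb1, mul_one]
  rw [hscale] at hupper
  set P := ∏ i : Fin d, ∏ j ∈ Finset.Ioi i, |a j - a i|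
  set N := euclNorm ((fun i => (v i : ℝ)) ᵥ* (g * Matrix.diagonal b))
  have hN : 0 ≤ N := Real.sqrt_nonneg _
  have hP0 : 0 ≤ P := Finset.prod_nonneg fun i _ => Finset.prod_nonneg fun j _ => abs_nonneg _
  have hP : 0 < P := hP0.lt_of_ne fun h => by
    rw [← h, zero_mul] at hlower
    exact absurd hlower (by norm_num)
  have hPN : P⁻¹ ≤ N ^ d := ((inv_le_iff_one_le_mul₀' hP).mpr hlower).trans hupper
  calc P ^ (-(1 : ℝ) / d) = P⁻¹ ^ ((d : ℝ)⁻¹) := by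
        rw [neg_div, one_div, Real.rpow_neg hP0, Real.inv_rpow hP0]
    _ ≤ (N ^ d) ^ ((d : ℝ)⁻¹) := Real.rpow_le_rpow (inv_nonneg.mpr hP0) hPN (by positivity)
    _ = N := Real.pow_rpow_inv_natCast hN (by omega)
end

section
/- Let d ≥ 2. For all ϑ > 0 and D > 0 there exist constants C > 0 and C₈ > 0 with the following property: for every t > C and every g ∈ SL(d,ℝ) with e^{ϑt} ≤ 1/s(g) ≤ e^{Dt}, there exists a diagonal matrix b with positive diagonal entries b_1,…,b_d and det b = 1 such that the Euclidean norm of the vector (log b_1, …, log b_d) is at most C₈·t and e^{ϑt/4} < 1/s(g·b) < e^{ϑt/2}. -/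
open Matrix

/-- Among the vectors of `L` outside a subspace there is one which is shortest up to a factor
two, provided nonzero vectors of `L` are bounded away from zero. -/
theorem exists_nearly_shortest {E : Type*} [NormedAddCommGroup E] [NormedSpace ℝ E]
    {L : Set E} {s : ℝ} (hs : 0 < s) (hL : ∀ x ∈ L, x ≠ 0 → s ≤ ‖x‖) (S : Submodule ℝ E)
    (hS : ∃ x ∈ L, x ∉ S) :
    ∃ x ∈ L, x ∉ S ∧ ∀ y ∈ L, y ∉ S → ‖x‖ ≤ 2 * ‖y‖ := by
  set A : Set ℝ := {r | ∃ x ∈ L, x ∉ S ∧ ‖x‖ = r} with hA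
  have hne : A.Nonempty := by
    obtain ⟨x, hx, hxS⟩ := hS
    exact ⟨‖x‖, x, hx, hxS, rfl⟩
  have hlow : ∀ r ∈ A, s ≤ r := by
    rintro r ⟨x, hx, hxS, rfl⟩
    exact hL x hx fun h => hxS (h ▸ S.zero_mem)
  have hI : s ≤ sInf A := le_csInf hne hlow
  obtain ⟨r, ⟨x, hx, hxS, rfl⟩, hr⟩ :=
    exists_lt_of_csInf_lt hne (show sInf A < 2 * sInf A by linarith)
  refine ⟨x, hx, hxS, fun y hy hyS => ?_⟩
  have : sInf A ≤ ‖y‖ := csInf_le ⟨s, hlow⟩ ⟨y, hy, hyS, rfl⟩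
  linarith

/-- Vectors of a spanning set realising its successive minima up to a factor two, together with
the flag they generate. -/
theorem exists_flag_nearly_shortest {E : Type*} [NormedAddCommGroup E] [NormedSpace ℝ E]
    [FiniteDimensional ℝ E] {d : ℕ} (hd : Module.finrank ℝ E = d) {L : Set E} {s : ℝ}
    (hs : 0 < s) (hL : ∀ x ∈ L, x ≠ 0 → s ≤ ‖x‖) (hspan : Submodule.span ℝ L = ⊤) :
    ∃ (S : ℕ → Submodule ℝ E) (w : Fin d → E),
      S 0 = ⊥ ∧ S d = ⊤ ∧ Monotone S ∧
      (∀ n : ℕ, Module.finrank ℝ (S n) ≤ n) ∧ LinearIndependent ℝ w ∧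
      ∀ i, w i ∈ L ∧ w i ∉ S i ∧ ∀ y ∈ L, y ∉ S i → ‖w i‖ ≤ 2 * ‖y‖ := by
  subst hd
  have hex : ∀ S : Submodule ℝ E, S ≠ ⊤ → ∃ x ∈ L, x ∉ S := by
    intro S hS
    by_contra! h
    exact hS (top_le_iff.1 (hspan ▸ Submodule.span_le.2 h))
  have hch : ∀ S : Submodule ℝ E, ∃ x : E,
      S ≠ ⊤ → x ∈ L ∧ x ∉ S ∧ ∀ y ∈ L, y ∉ S → ‖x‖ ≤ 2 * ‖y‖ := by
    intro S
    by_cases hS : S = ⊤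
    · exact ⟨0, fun h => (h hS).elim⟩
    · obtain ⟨x, h1, h2, h3⟩ := exists_nearly_shortest hs hL S (hex S hS)
      exact ⟨x, fun _ => ⟨h1, h2, h3⟩⟩
  choose f hf using hch
  obtain ⟨S, hS0, hSs⟩ : ∃ S : ℕ → Submodule ℝ E,
      S 0 = ⊥ ∧ ∀ n, S (n + 1) = S n ⊔ Submodule.span ℝ {f (S n)} :=
    ⟨fun n => Nat.rec ⊥ (fun _ T => T ⊔ Submodule.span ℝ {f T}) n, rfl, fun _ => rfl⟩
  have hmono : Monotone S := monotone_nat_of_le_succ fun n => by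
    rw [hSs]
    exact le_sup_left
  have hle : ∀ n : ℕ, Module.finrank ℝ (S n) ≤ n := by
    intro n
    induction n with
    | zero => simp [hS0]
    | succ n ih =>
      rw [hSs]
      have h1 := Submodule.finrank_add_le_finrank_add_finrank (S n) (Submodule.span ℝ {f (S n)})
      have h2 : Module.finrank ℝ (Submodule.span ℝ {f (S n)}) ≤ 1 := by
        simpa using finrank_span_le_card (R := ℝ) ({f (S n)} : Set E)
      omega
  have hnt : ∀ n, n < Module.finrank ℝ E → S n ≠ ⊤ := by
    intro n hn h
    have := hle n
    rw [h, finrank_top] at this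
    omega
  have hge : ∀ n : ℕ, n ≤ Module.finrank ℝ E → n ≤ Module.finrank ℝ (S n) := by
    intro n
    induction n with
    | zero => simp
    | succ n ih =>
      intro hn
      have hlt : S n < S (n + 1) := by
        refine lt_of_le_of_ne (hmono n.le_succ) fun h => ?_
        apply (hf (S n) (hnt n (by omega))).2.1
        have hmem : f (S n) ∈ S (n + 1) := by
          rw [hSs]
          exact (le_sup_right : _ ≤ S n ⊔ _) (Submodule.mem_span_singleton_self _)
        exact h.symm ▸ hmem
      have := Submodule.finrank_lt_finrank_of_lt hlt
      have := ih (by omega)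
      omega
  have hSd : S (Module.finrank ℝ E) = ⊤ :=
    Submodule.eq_top_of_finrank_eq (le_antisymm (hle _) (hge _ le_rfl))
  refine ⟨S, fun i => f (S i), hS0, hSd, hmono, hle, ?_, fun i => hf _ (hnt i i.2)⟩
  apply linearIndependent_of_top_le_span_of_card_eq_finrank
  · rw [← hSd]
    have : ∀ n, n ≤ Module.finrank ℝ E →
        S n ≤ Submodule.span ℝ (Set.range fun i : Fin (Module.finrank ℝ E) => f (S i)) := by
      intro n
      induction n with
      | zero => simp [hS0]
      | succ n ih =>
        intro hn
        rw [hSs]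
        refine sup_le (ih (by omega)) ?_
        rw [Submodule.span_singleton_le_iff_mem]
        exact Submodule.subset_span ⟨⟨n, hn⟩, rfl⟩
    exact this _ le_rfl
  · simp

/-- If there are more coordinates than the dimension of a subspace, then one of them is
controlled on the subspace by the others. -/
theorem exists_coord_le_of_finrank_lt {κ ι : Type*} [Fintype κ] [Fintype ι]
    (T : Submodule ℝ (κ → ℝ)) (p : ι → κ) (hT : Module.finrank ℝ T < Fintype.card ι) :
    ∃ k : ι, ∀ x ∈ T, ∀ B : ℝ, 0 ≤ B → (∀ i, i ≠ k → |x (p i)| ≤ B) →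
      |x (p k)| ≤ Fintype.card ι * B := by
  classical
  let φ : T →ₗ[ℝ] (ι → ℝ) := (LinearMap.funLeft ℝ ℝ p).comp T.subtype
  have hlt : LinearMap.range φ < ⊤ := by
    rw [lt_top_iff_ne_top]
    intro h
    have h1 := LinearMap.finrank_range_le φ
    rw [h, finrank_top, Module.finrank_fintype_fun_eq_card] at h1
    omega
  obtain ⟨f, hf0, hf⟩ := Submodule.exists_le_ker_of_lt_top _ hlt
  let α : ι → ℝ := fun i => f (Pi.single i 1)
  have hfe : ∀ y, f y = ∑ i, y i * α i := fun y => by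
    conv_lhs => rw [pi_eq_sum_univ' y]
    simp only [map_sum, map_smul, smul_eq_mul, α]
  have hne : Nonempty ι := Fintype.card_pos_iff.1 (by omega)
  obtain ⟨k, hk⟩ := Finite.exists_max fun i => |α i|
  have hαk : 0 < |α k| := by
    rw [abs_pos]
    intro h0
    apply hf0
    ext y
    have : ∀ i, α i = 0 := fun i => by
      have := hk i
      rw [h0, abs_zero] at this
      exact abs_nonpos_iff.1 this
    simp [hfe, this]
  refine ⟨k, fun x hx B hB h => ?_⟩
  have hrel : ∑ i, x (p i) * α i = 0 := by
    rw [← hfe fun i => x (p i)]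
    exact hf ⟨⟨x, hx⟩, rfl⟩
  rw [← Finset.add_sum_erase _ _ (Finset.mem_univ k)] at hrel
  have hb : |x (p k)| * |α k| ≤ (Fintype.card ι * B) * |α k| := by
    rw [← abs_mul, eq_neg_of_add_eq_zero_left hrel, abs_neg]
    calc |∑ i ∈ Finset.univ.erase k, x (p i) * α i|
        ≤ ∑ i ∈ Finset.univ.erase k, |x (p i) * α i| := Finset.abs_sum_le_sum_abs _ _
      _ ≤ ∑ i ∈ Finset.univ.erase k, B * |α k| := by
          refine Finset.sum_le_sum fun i hi => ?_
          rw [abs_mul]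
          exact mul_le_mul (h i (Finset.ne_of_mem_erase hi)) (hk i) (abs_nonneg _) hB
      _ ≤ ∑ i : ι, B * |α k| :=
          Finset.sum_le_sum_of_subset_of_nonneg (Finset.erase_subset _ _)
            fun _ _ _ => by positivity
      _ = (Fintype.card ι * B) * |α k| := by
          rw [Finset.sum_const, Finset.card_univ, nsmul_eq_mul]
          ring
  exact le_of_mul_le_mul_right hb hαk

/-- For a flag of subspaces of `ℝ^d` there is an ordering of the coordinates such that on the
`j`-th subspace all coordinates are controlled by the first `j` ones. -/
theorem exists_perm_coord_le {d : ℕ} (S : ℕ → Submodule ℝ (Fin d → ℝ))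
    (hS : Monotone S) (hfin : ∀ n : ℕ, Module.finrank ℝ (S n) ≤ n) :
    ∃ σ : Equiv.Perm (Fin d), ∀ j ≤ d, ∀ x ∈ S j, ∀ B : ℝ, 0 ≤ B →
      (∀ i : Fin d, (i : ℕ) < j → |x (σ i)| ≤ B) → ∀ i, |x i| ≤ (d : ℝ) ^ d * B := by
  suffices H : ∀ k ≤ d, ∃ σ : Equiv.Perm (Fin d), ∀ j ≤ d, d - k ≤ j → ∀ x ∈ S j,
      ∀ B : ℝ, 0 ≤ B → (∀ i : Fin d, (i : ℕ) < j → |x (σ i)| ≤ B) →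
      ∀ i, |x i| ≤ (d : ℝ) ^ k * B by
    obtain ⟨σ, hσ⟩ := H d le_rfl
    exact ⟨σ, fun j hj => hσ j hj (by omega)⟩
  intro k
  induction k with
  | zero =>
    intro _
    refine ⟨1, fun j hj hj' x _ B _ h i => ?_⟩
    simpa using h i (by omega)
  | succ k ih =>
    intro hk
    obtain ⟨σ, hσ⟩ := ih (by omega)
    have hd1 : (1 : ℝ) ≤ d := by exact_mod_cast (by omega : 1 ≤ d)
    set m : ℕ := d - (k + 1) with hm
    have hmd : m + 1 ≤ d := by omega
    obtain ⟨l, hl⟩ := exists_coord_le_of_finrank_lt (S m)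
      (fun i : Fin (m + 1) => σ (Fin.castLE hmd i))
      (by rw [Fintype.card_fin]; exact Nat.lt_succ_of_le (hfin m))
    let top : Fin d := Fin.castLE hmd (Fin.last m)
    let l' : Fin d := Fin.castLE hmd l
    have hl'm : (l' : ℕ) < m + 1 := l.2
    have htop : (top : ℕ) = m := rfl
    refine ⟨(Equiv.swap l' top).trans σ, fun j hj hj' x hx B hB h => ?_⟩
    have h' : ∀ i : Fin d, (i : ℕ) < j → |x (σ (Equiv.swap l' top i))| ≤ B := h
    rcases Nat.lt_or_ge m j with hmj | hmj
    · intro i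
      refine (hσ j hj (by omega) x hx B hB (fun i hi => ?_) i).trans ?_
      · have := h' (Equiv.swap l' top i) ?_
        · simpa using this
        · rw [Equiv.swap_apply_def]
          split_ifs <;> omega
      · gcongr
        exact k.le_succ
    · have hjm : j = m := by omega
      subst hjm
      have hother : ∀ i : Fin d, (i : ℕ) < m + 1 → i ≠ l' → |x (σ i)| ≤ B := by
        intro i hi hil
        have := h' (Equiv.swap l' top i) ?_
        · simpa using this
        · rw [Equiv.swap_apply_def]
          have h1 : i = top → l' ≠ top := fun h1 h2 => hil (h1.trans h2.symm)
          have h2 : (l' : ℕ) = m → l' = top := fun h => Fin.ext h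
          have h3 : (i : ℕ) = m → i = top := fun h => Fin.ext h
          split_ifs with h4 h5
          · exact absurd h4 hil
          · have := h1 h5
            have : (l' : ℕ) ≠ m := fun h => this (h2 h)
            omega
          · have : (i : ℕ) ≠ m := fun h => h5 (h3 h)
            omega
      have hcard : ((Fintype.card (Fin (m + 1)) : ℕ) : ℝ) ≤ d := by
        rw [Fintype.card_fin]
        exact_mod_cast hmd
      have hBd : B ≤ d * B := le_mul_of_one_le_left hB hd1
      have hlast : |x (σ l')| ≤ d * B :=
        (hl x hx B hB fun i hi => hother _ i.2 fun h => hi (by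
          simpa [l', Fin.ext_iff] using h)).trans (mul_le_mul_of_nonneg_right hcard hB)
      intro i
      rw [pow_succ, mul_assoc]
      refine hσ (m + 1) hmd (by omega) x (hS m.le_succ hx) (d * B) (by positivity)
        (fun i hi => ?_) i
      by_cases hil : i = l'
      · rw [hil]
        exact hlast
      · exact (hother i hi hil).trans hBd

/-- The determinant is at most `d!` times the product of the sup norms of the rows. -/
theorem abs_det_le_factorial_mul_prod_norm {d : ℕ} (w : Fin d → Fin d → ℝ) :
    |(Matrix.of w).det| ≤ d.factorial * ∏ i, ‖w i‖ := by
  rw [← Matrix.det_transpose, Matrix.det_apply]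
  calc |∑ σ : Equiv.Perm (Fin d), Equiv.Perm.sign σ • ∏ i, w i (σ i)|
      ≤ ∑ σ : Equiv.Perm (Fin d), |Equiv.Perm.sign σ • ∏ i, w i (σ i)| :=
        Finset.abs_sum_le_sum_abs _ _
    _ ≤ ∑ σ : Equiv.Perm (Fin d), ∏ i, ‖w i‖ := by
        refine Finset.sum_le_sum fun σ _ => ?_
        have h1 : |Equiv.Perm.sign σ • ∏ i, w i (σ i)| =
            |∏ i, w i (σ i)| := by
          rcases Int.units_eq_one_or (Equiv.Perm.sign σ) with h | h <;> simp [h]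
        rw [h1, Finset.abs_prod]
        exact Finset.prod_le_prod (fun _ _ => abs_nonneg _) fun i _ => norm_le_pi_norm (w i) (σ i)
    _ = d.factorial * ∏ i, ‖w i‖ := by
        rw [Finset.sum_const, Finset.card_univ, Fintype.card_perm, Fintype.card_fin, nsmul_eq_mul]

/-- A discrete set of covolume at least one, all of whose nonzero vectors have length at least
`s`, is brought by a unimodular positive diagonal matrix of size controlled by `s` to a position
where nonzero vectors are bounded from below in terms of the dimension only. -/
theorem exists_diagonal_lower_bound {d : ℕ} (hd : 0 < d) {L : Set (Fin d → ℝ)} {s : ℝ}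
    (hs : 0 < s) (hs1 : s ≤ 1) (hL : ∀ x ∈ L, x ≠ 0 → s ≤ ‖x‖)
    (hspan : Submodule.span ℝ L = ⊤)
    (hdet : ∀ w : Fin d → Fin d → ℝ, (∀ i, w i ∈ L) → LinearIndependent ℝ w →
      1 ≤ |(Matrix.of w).det|) :
    ∃ a : Fin d → ℝ, ∑ i, a i = 0 ∧ (∀ i, |a i| ≤ 2 * d * (-Real.log s)) ∧
      ∀ x ∈ L, x ≠ 0 →
        1 / (4 * (d : ℝ) ^ d * d.factorial) ≤ ‖fun i => x i * Real.exp (a i)‖ := by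
  obtain ⟨S, w, hS0, hSd, hmono, hfin, hli, hw⟩ :=
    exists_flag_nearly_shortest (d := d) (by simp) hs hL hspan
  obtain ⟨σ, hσ⟩ := exists_perm_coord_le S hmono hfin
  have hdR : (1 : ℝ) ≤ d := by exact_mod_cast hd
  have hdpos : (0 : ℝ) < d := by linarith
  have hfac : (1 : ℝ) ≤ d.factorial := by exact_mod_cast d.factorial_pos
  have hws : ∀ i, s ≤ ‖w i‖ := fun i => hL _ (hw i).1 (hli.ne_zero i)
  have hwpos : ∀ i, 0 < ‖w i‖ := fun i => hs.trans_le (hws i)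
  have hlogs : Real.log s ≤ 0 := Real.log_nonpos hs.le hs1
  -- logarithms of the minima, truncated so that they are bounded in terms of `s`
  let l : Fin d → ℝ := fun i => min (Real.log ‖w i‖) (d * (-Real.log s))
  have hl_low : ∀ i, Real.log s ≤ l i := fun i =>
    le_min (Real.log_le_log hs (hws i)) (by nlinarith)
  have hl_up : ∀ i, l i ≤ d * (-Real.log s) := fun i => min_le_right _ _
  have hl_mono : ∀ i j : Fin d, i ≤ j → l i ≤ l j + Real.log 2 := by
    intro i j hij
    have h2 : 0 ≤ Real.log 2 := Real.log_nonneg (by norm_num)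
    have h1 : Real.log ‖w i‖ ≤ Real.log ‖w j‖ + Real.log 2 := by
      rw [← Real.log_mul (hwpos j).ne' (by norm_num), mul_comm]
      exact Real.log_le_log (hwpos i)
        ((hw i).2.2 _ (hw j).1 fun h => (hw j).2.1 (hmono (by exact_mod_cast hij) h))
    rw [← sub_le_iff_le_add]
    refine le_min ?_ ?_
    · have : l i ≤ Real.log ‖w i‖ := min_le_left _ _
      linarith
    · linarith [hl_up i]
  set A : ℝ := (∑ i, l i) / d with hA
  have hAd : A * d = ∑ i, l i := div_mul_cancel₀ _ hdpos.ne'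
  have hA_low : -Real.log d.factorial ≤ A := by
    have hlf : 0 ≤ Real.log d.factorial := Real.log_nonneg hfac
    suffices h : -Real.log d.factorial ≤ ∑ i, l i by
      rw [hA, le_div_iff₀ hdpos]
      nlinarith
    by_cases hbig : ∃ j, d * (-Real.log s) < Real.log ‖w j‖
    · obtain ⟨j, hj⟩ := hbig
      have hlj : l j = d * (-Real.log s) := min_eq_right hj.le
      have : ∑ i ∈ Finset.univ.erase j, Real.log s ≤ ∑ i ∈ Finset.univ.erase j, l i :=
        Finset.sum_le_sum fun i _ => hl_low i
      rw [Finset.sum_const, Finset.card_erase_of_mem (Finset.mem_univ _), Finset.card_univ,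
        Fintype.card_fin, nsmul_eq_mul, Nat.cast_pred hd] at this
      rw [← Finset.add_sum_erase _ _ (Finset.mem_univ j), hlj]
      linarith
    · push Not at hbig
      have hle : ∀ i, l i = Real.log ‖w i‖ := fun i => min_eq_left (hbig i)
      have h1 := (hdet w (fun i => (hw i).1) hli).trans (abs_det_le_factorial_mul_prod_norm w)
      have h2 := Real.log_le_log one_pos h1
      rw [Real.log_one, Real.log_mul (by positivity)
        (Finset.prod_ne_zero_iff.2 fun i _ => (hwpos i).ne'),
        Real.log_prod fun i _ => (hwpos i).ne'] at h2
      simp only [hle]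
      linarith
  have hA_lows : Real.log s ≤ A := by
    rw [hA, le_div_iff₀ hdpos]
    have := Finset.sum_le_sum fun i (_ : i ∈ Finset.univ) => hl_low i
    rw [Finset.sum_const, Finset.card_univ, Fintype.card_fin, nsmul_eq_mul] at this
    linarith
  have hA_up : A ≤ d * (-Real.log s) := by
    rw [hA, div_le_iff₀ hdpos]
    have := Finset.sum_le_sum fun i (_ : i ∈ Finset.univ) => hl_up i
    rw [Finset.sum_const, Finset.card_univ, Fintype.card_fin, nsmul_eq_mul] at this
    linarith
  refine ⟨fun i => A - l (σ.symm i), ?_, fun i => ?_, fun x hx hx0 => ?_⟩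
  · rw [Finset.sum_sub_distrib, Equiv.sum_comp σ.symm l, ← hAd]
    simp [mul_comm]
  · have h1 := hl_low (σ.symm i)
    have h2 := hl_up (σ.symm i)
    rw [abs_le]
    constructor <;> nlinarith
  · -- the first step of the flag containing `x`
    have hxd : ∃ n, x ∈ S (n + 1) := by
      refine ⟨d - 1, ?_⟩
      rw [Nat.sub_add_cancel hd, hSd]
      trivial
    classical
    set n := Nat.find hxd with hn
    have hxn : x ∈ S (n + 1) := Nat.find_spec hxd
    have hxn' : x ∉ S n := by
      rcases Nat.eq_zero_or_pos n with h0 | h0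
      · rw [h0, hS0]
        exact hx0
      · have := Nat.find_min hxd (m := n - 1) (by omega)
        rwa [Nat.sub_add_cancel h0] at this
    have hnd : n < d := by
      by_contra h
      apply hxn'
      have := hmono (not_lt.1 h)
      rw [hSd] at this
      exact this trivial
    let j : Fin d := ⟨n, hnd⟩
    have hxj : ‖w j‖ ≤ 2 * ‖x‖ := (hw j).2.2 x hx hxn'
    have hxpos : 0 < ‖x‖ := norm_pos_iff.2 hx0
    set ε : ℝ := ‖fun i => x i * Real.exp (A - l (σ.symm i))‖ with hε
    have hε0 : 0 ≤ ε := norm_nonneg _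
    have hcoord : ∀ i : Fin d, (i : ℕ) < n + 1 →
        |x (σ i)| ≤ ε * (2 * Real.exp (l j) * d.factorial) := by
      intro i hi
      have h1 : |x (σ i)| * Real.exp (A - l i) ≤ ε := by
        have := norm_le_pi_norm (fun i => x i * Real.exp (A - l (σ.symm i))) (σ i)
        simpa [abs_mul] using this
      have h2 : l i ≤ l j + Real.log 2 := hl_mono i j (by
        rw [Fin.le_def]
        exact Nat.le_of_lt_succ hi)
      have h3 : |x (σ i)| = |x (σ i)| * Real.exp (A - l i) * Real.exp (l i - A) := by
        rw [mul_assoc, ← Real.exp_add]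
        simp
      have h4 : Real.exp (l i - A) ≤ 2 * Real.exp (l j) * d.factorial := by
        calc Real.exp (l i - A)
            ≤ Real.exp (Real.log 2 + l j + Real.log d.factorial) :=
              Real.exp_le_exp.2 (by linarith)
          _ = 2 * Real.exp (l j) * d.factorial := by
              rw [Real.exp_add, Real.exp_add, Real.exp_log (by norm_num),
                Real.exp_log (by positivity)]
      rw [h3]
      exact mul_le_mul h1 h4 (Real.exp_pos _).le hε0
    have hall := hσ (n + 1) hnd x hxn _ (by positivity) hcoord
    have hxle : ‖x‖ ≤ (d : ℝ) ^ d * (ε * (2 * Real.exp (l j) * d.factorial)) :=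
      (pi_norm_le_iff_of_nonneg (by positivity)).2 hall
    have hlj : Real.exp (l j) ≤ 2 * ‖x‖ := by
      refine le_trans ?_ hxj
      rw [← Real.le_log_iff_exp_le (hwpos j)]
      exact min_le_left _ _
    have hfinal : ‖x‖ * 1 ≤ ‖x‖ * (ε * (4 * (d : ℝ) ^ d * d.factorial)) := by
      calc ‖x‖ * 1 = ‖x‖ := mul_one _
        _ ≤ (d : ℝ) ^ d * (ε * (2 * Real.exp (l j) * d.factorial)) := hxle
        _ ≤ (d : ℝ) ^ d * (ε * (2 * (2 * ‖x‖) * d.factorial)) := by gcongr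
        _ = ‖x‖ * (ε * (4 * (d : ℝ) ^ d * d.factorial)) := by ring
    rw [div_le_iff₀ (by positivity)]
    exact le_of_mul_le_mul_left hfinal hxpos

theorem norm_le_euclNorm {d : ℕ} (v : Fin d → ℝ) : ‖v‖ ≤ euclNorm v := by
  refine (pi_norm_le_iff_of_nonneg (Real.sqrt_nonneg _)).2 fun i => ?_
  rw [Real.norm_eq_abs]
  exact Real.abs_le_sqrt
    (Finset.single_le_sum (f := fun i => v i ^ 2) (fun _ _ => sq_nonneg _) (Finset.mem_univ i))

theorem euclNorm_le_of_abs_le {d : ℕ} {v : Fin d → ℝ} {B : ℝ} (hB : 0 ≤ B)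
    (h : ∀ i, |v i| ≤ B) : euclNorm v ≤ d * B := by
  refine Real.sqrt_le_iff.2 ⟨by positivity, ?_⟩
  calc ∑ i, v i ^ 2 ≤ ∑ _i : Fin d, B ^ 2 :=
        Finset.sum_le_sum fun i _ => sq_le_sq' (abs_le.1 (h i)).1 (abs_le.1 (h i)).2
    _ = d * B ^ 2 := by simp
    _ ≤ (d * B) ^ 2 := by
        rw [mul_pow]
        have : (d : ℝ) ≤ (d : ℝ) ^ 2 := by exact_mod_cast Nat.le_self_pow two_ne_zero d
        exact mul_le_mul_of_nonneg_right this (sq_nonneg B)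

theorem systole_le {d : ℕ} (g : Matrix (Fin d) (Fin d) ℝ) {v : Fin d → ℤ} (hv : v ≠ 0) :
    systole g ≤ euclNorm ((fun i => (v i : ℝ)) ᵥ* g) :=
  csInf_le ⟨0, by rintro r ⟨v, -, rfl⟩; exact Real.sqrt_nonneg _⟩ ⟨v, hv, rfl⟩

theorem le_systole {d : ℕ} (hd : 0 < d) {g : Matrix (Fin d) (Fin d) ℝ} {c : ℝ}
    (h : ∀ v : Fin d → ℤ, v ≠ 0 → c ≤ euclNorm ((fun i => (v i : ℝ)) ᵥ* g)) :
    c ≤ systole g := by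
  refine le_csInf ⟨_, Pi.single ⟨0, hd⟩ 1, by simp, rfl⟩ ?_
  rintro r ⟨v, hv, rfl⟩
  exact h v hv

/-- Multiplying the coordinates by factors of absolute value at most `c` multiplies the length by
at most `c`. -/
theorem euclNorm_mul_le {d : ℕ} (v u : Fin d → ℝ) {c : ℝ} (hc : 0 ≤ c) (hu : ∀ i, |u i| ≤ c) :
    euclNorm (fun i => v i * u i) ≤ c * euclNorm v := by
  refine Real.sqrt_le_iff.2 ⟨mul_nonneg hc (Real.sqrt_nonneg _), ?_⟩
  rw [mul_pow, euclNorm, Real.sq_sqrt (Finset.sum_nonneg fun _ _ => sq_nonneg _), Finset.mul_sum]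
  refine Finset.sum_le_sum fun i _ => ?_
  rw [mul_pow, mul_comm]
  exact mul_le_mul_of_nonneg_right (sq_le_sq' (abs_le.1 (hu i)).1 (abs_le.1 (hu i)).2)
    (sq_nonneg _)

theorem systole_mul_diagonal_exp_le {d : ℕ} (hd : 0 < d) (g : Matrix (Fin d) (Fin d) ℝ)
    {a : Fin d → ℝ} {K : ℝ} (ha : ∀ i, |a i| ≤ K) (τ τ' : ℝ) :
    systole (g * Matrix.diagonal fun i => Real.exp (τ' * a i)) ≤
      Real.exp (|τ' - τ| * K) * systole (g * Matrix.diagonal fun i => Real.exp (τ * a i)) := by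
  rw [← div_le_iff₀' (Real.exp_pos _)]
  refine le_systole hd fun v hv => ?_
  rw [div_le_iff₀' (Real.exp_pos _)]
  refine (systole_le _ hv).trans ?_
  have h : ((fun i => (v i : ℝ)) ᵥ* (g * Matrix.diagonal fun i => Real.exp (τ' * a i))) =
      fun i => ((fun i => (v i : ℝ)) ᵥ* (g * Matrix.diagonal fun i => Real.exp (τ * a i))) i *
        Real.exp ((τ' - τ) * a i) := by
    ext i
    rw [← Matrix.vecMul_vecMul, ← Matrix.vecMul_vecMul, Matrix.vecMul_diagonal,
      Matrix.vecMul_diagonal, mul_assoc, ← Real.exp_add]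
    ring_nf
  rw [h]
  refine euclNorm_mul_le _ _ (Real.exp_pos _).le fun i => ?_
  rw [abs_of_pos (Real.exp_pos _), Real.exp_le_exp]
  refine (le_abs_self _).trans ?_
  rw [abs_mul]
  exact mul_le_mul_of_nonneg_left (ha i) (abs_nonneg _)

/-- The systole varies continuously along a one-parameter group of diagonal matrices. -/
theorem continuous_systole_mul_diagonal_exp {d : ℕ} (hd : 0 < d)
    (g : Matrix (Fin d) (Fin d) ℝ) (a : Fin d → ℝ) :
    Continuous fun τ : ℝ => systole (g * Matrix.diagonal fun i => Real.exp (τ * a i)) := by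
  have ha : ∀ i, |a i| ≤ ‖a‖ := fun i => norm_le_pi_norm a i
  set F : ℝ → ℝ := fun τ => systole (g * Matrix.diagonal fun i => Real.exp (τ * a i)) with hF
  rw [continuous_iff_continuousAt]
  intro τ
  have hup : Filter.Tendsto (fun τ' => Real.exp (|τ' - τ| * ‖a‖) * F τ) (nhds τ)
      (nhds (F τ)) := by
    have : Continuous fun τ' => Real.exp (|τ' - τ| * ‖a‖) * F τ := by fun_prop
    simpa using this.tendsto τ
  have hlow : Filter.Tendsto (fun τ' => Real.exp (-(|τ' - τ| * ‖a‖)) * F τ) (nhds τ)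
      (nhds (F τ)) := by
    have : Continuous fun τ' => Real.exp (-(|τ' - τ| * ‖a‖)) * F τ := by fun_prop
    simpa using this.tendsto τ
  refine tendsto_of_tendsto_of_tendsto_of_le_of_le hlow hup (fun τ' => ?_) fun τ' =>
    systole_mul_diagonal_exp_le hd g ha τ τ'
  have := systole_mul_diagonal_exp_le hd g ha τ' τ
  rw [abs_sub_comm] at this
  simp only
  rw [Real.exp_neg, inv_mul_le_iff₀ (Real.exp_pos _)]
  exact this

/-- A unimodular lattice whose systole is at least `d * s` can be moved by a unimodular positive
diagonal matrix of size controlled by `s` so that its systole is bounded from below in terms of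
the dimension only. -/
theorem exists_diagonal_le_systole {d : ℕ} (hd : 0 < d) {g : Matrix (Fin d) (Fin d) ℝ}
    (hg : g.det = 1) {s : ℝ} (hs : 0 < s) (hs1 : s ≤ 1) (hsg : d * s ≤ systole g) :
    ∃ a : Fin d → ℝ, ∑ i, a i = 0 ∧ (∀ i, |a i| ≤ 2 * d * (-Real.log s)) ∧
      1 / (4 * (d : ℝ) ^ d * d.factorial) ≤
        systole (g * Matrix.diagonal fun i => Real.exp (a i)) := by
  have hdR : (0 : ℝ) < d := by exact_mod_cast hd
  have hinj : Function.Injective fun x : Fin d → ℝ => x ᵥ* g :=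
    Matrix.vecMul_injective_iff_isUnit.2 ((Matrix.isUnit_iff_isUnit_det _).2 (by simp [hg]))
  have hne : ∀ v : Fin d → ℤ, v ≠ 0 → (fun i => (v i : ℝ)) ᵥ* g ≠ 0 := by
    intro v hv h
    apply hv
    have h0 : (fun i => (v i : ℝ)) = 0 := hinj (by simpa using h)
    ext i
    have hi : (v i : ℝ) = 0 := congrFun h0 i
    exact_mod_cast hi
  let L : Set (Fin d → ℝ) := Set.range fun v : Fin d → ℤ => (fun i => (v i : ℝ)) ᵥ* g
  have hL : ∀ x ∈ L, x ≠ 0 → s ≤ ‖x‖ := by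
    rintro _ ⟨v, rfl⟩ hx
    have hv : v ≠ 0 := by
      rintro rfl
      apply hx
      ext i
      simp [Matrix.vecMul, dotProduct]
    have h1 := hsg.trans (systole_le g hv)
    have h2 := h1.trans (euclNorm_le_of_abs_le (norm_nonneg _)
      fun i => norm_le_pi_norm ((fun i => (v i : ℝ)) ᵥ* g) i)
    exact le_of_mul_le_mul_left h2 hdR
  have hspan : Submodule.span ℝ L = ⊤ := by
    rw [eq_top_iff]
    have hrow : ∀ i, g i ∈ L := fun i => ⟨Pi.single i 1, by
      have : (fun j => ((Pi.single i 1 : Fin d → ℤ) j : ℝ)) = Pi.single i 1 := by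
        ext j
        by_cases h : j = i
        · subst h
          simp
        · simp [h]
      simp only [this, Matrix.single_one_vecMul]
      rfl⟩
    have hli : LinearIndependent ℝ g.row := Matrix.linearIndependent_rows_iff_isUnit.2
      ((Matrix.isUnit_iff_isUnit_det _).2 (by simp [hg]))
    rw [← hli.span_eq_top_of_card_eq_finrank' (by simp)]
    refine Submodule.span_mono ?_
    rintro _ ⟨i, rfl⟩
    exact hrow i
  have hdet : ∀ w : Fin d → Fin d → ℝ, (∀ i, w i ∈ L) → LinearIndependent ℝ w →
      1 ≤ |(Matrix.of w).det| := by
    intro w hw hli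
    choose V hV using hw
    have hwV : Matrix.of w = ((Matrix.of V).map (Int.castRingHom ℝ)) * g := by
      ext i j
      rw [Matrix.of_apply, ← hV]
      rfl
    have hdet0 : (Matrix.of w).det ≠ 0 := by
      have hu : IsUnit (Matrix.of w) := Matrix.linearIndependent_rows_iff_isUnit.1 hli
      exact ((Matrix.isUnit_iff_isUnit_det _).1 hu).ne_zero
    rw [hwV, Matrix.det_mul, hg, mul_one, ← RingHom.mapMatrix_apply, ← RingHom.map_det] at hdet0 ⊢
    have hz : (Matrix.of V).det ≠ 0 := fun h => hdet0 (by rw [h, map_zero])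
    have := Int.one_le_abs hz
    rw [eq_intCast]
    exact_mod_cast this
  obtain ⟨a, ha0, ha, hb⟩ := exists_diagonal_lower_bound hd hs hs1 hL hspan hdet
  refine ⟨a, ha0, ha, le_systole hd fun v hv => ?_⟩
  refine (hb _ ⟨v, rfl⟩ (hne v hv)).trans ((norm_le_euclNorm _).trans (le_of_eq ?_))
  congr 1
  ext i
  rw [← Matrix.vecMul_vecMul, Matrix.vecMul_diagonal]

theorem stmt6 (d : ℕ) (hd : 2 ≤ d) (ϑ D : ℝ) (hϑ : 0 < ϑ) (hD : 0 < D) :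
    ∃ C > (0 : ℝ), ∃ C₈ > (0 : ℝ), ∀ t : ℝ, t > C →
      ∀ g : Matrix (Fin d) (Fin d) ℝ, g.det = 1 →
        Real.exp (ϑ * t) ≤ 1 / systole g → 1 / systole g ≤ Real.exp (D * t) →
        ∃ b : Fin d → ℝ, (∀ i, 0 < b i) ∧ (∏ i, b i) = 1 ∧
          euclNorm (fun i => Real.log (b i)) ≤ C₈ * t ∧
          Real.exp (ϑ * t / 4) < 1 / systole (g * Matrix.diagonal b) ∧
          1 / systole (g * Matrix.diagonal b) < Real.exp (ϑ * t / 2) := by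
  have hd0 : 0 < d := by omega
  have hdR : (1 : ℝ) ≤ d := by exact_mod_cast hd0
  have hlogd : 0 ≤ Real.log d := Real.log_nonneg hdR
  set N : ℝ := 4 * (d : ℝ) ^ d * d.factorial with hN
  have hN1 : 1 ≤ N := by
    have h1 : (1 : ℝ) ≤ (d : ℝ) ^ d := one_le_pow₀ hdR
    have h2 : (1 : ℝ) ≤ d.factorial := by exact_mod_cast d.factorial_pos
    nlinarith [mul_le_mul h1 h2 zero_le_one (by positivity)]
  have hlogN : 0 ≤ Real.log N := Real.log_nonneg hN1
  refine ⟨1 + 8 / (3 * ϑ) * Real.log N, by positivity, d * (2 * d * (D + Real.log d)),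
    by positivity, fun t ht g hg hlow hup => ?_⟩
  have ht1 : 1 ≤ t := by
    have : 0 ≤ 8 / (3 * ϑ) * Real.log N := by positivity
    linarith
  have hNt : Real.log N ≤ 3 * ϑ * t / 8 := by
    have h1 : 8 / (3 * ϑ) * Real.log N ≤ t := by linarith
    rw [div_mul_eq_mul_div, div_le_iff₀ (by positivity)] at h1
    linarith
  have hsys : 0 < systole g := one_div_pos.1 ((Real.exp_pos _).trans_le hlow)
  have hs_up : systole g ≤ Real.exp (-(3 * ϑ * t / 8)) := by
    rw [le_one_div (Real.exp_pos _) hsys, one_div, ← Real.exp_neg] at hlow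
    refine hlow.trans (Real.exp_le_exp.2 ?_)
    nlinarith [mul_pos hϑ (zero_lt_one.trans_le ht1)]
  have hs_low : Real.exp (-(D * t)) ≤ systole g := by
    rwa [one_div_le hsys (Real.exp_pos _), one_div, ← Real.exp_neg] at hup
  set s : ℝ := Real.exp (-(D * t) - Real.log d) with hs
  have hds : d * s = Real.exp (-(D * t)) := by
    rw [hs, Real.exp_sub, Real.exp_log (by linarith)]
    field_simp
  obtain ⟨a, ha0, ha, hb⟩ := exists_diagonal_le_systole hd0 hg (Real.exp_pos _)
    (Real.exp_le_one_iff.2 (by nlinarith)) (hds.le.trans hs_low)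
  rw [Real.log_exp] at ha
  have hc := continuous_systole_mul_diagonal_exp hd0 g a
  have hmem : Real.exp (-(3 * ϑ * t / 8)) ∈ Set.Icc
      ((fun τ : ℝ => systole (g * Matrix.diagonal fun i => Real.exp (τ * a i))) 0)
      ((fun τ : ℝ => systole (g * Matrix.diagonal fun i => Real.exp (τ * a i))) 1) := by
    constructor
    · simpa using hs_up
    · simp only [one_mul]
      refine le_trans ?_ hb
      rw [Real.exp_neg, ← one_div]
      refine one_div_le_one_div_of_le (by linarith) ?_
      rwa [← Real.log_le_iff_le_exp (by linarith)]
  obtain ⟨τ, ⟨hτ0, hτ1⟩, hτ⟩ := intermediate_value_Icc zero_le_one hc.continuousOn hmem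
  have hτ' : 1 / systole (g * Matrix.diagonal fun i => Real.exp (τ * a i)) =
      Real.exp (3 * ϑ * t / 8) := by
    simp only at hτ
    rw [hτ, Real.exp_neg, one_div, inv_inv]
  have hϑt : 0 < ϑ * t := by positivity
  refine ⟨fun i => Real.exp (τ * a i), fun i => Real.exp_pos _, ?_, ?_, ?_, ?_⟩
  · rw [← Real.exp_sum, ← Finset.mul_sum, ha0, mul_zero, Real.exp_zero]
  · simp only [Real.log_exp]
    rw [mul_assoc]
    refine euclNorm_le_of_abs_le (by positivity) fun i => ?_
    rw [abs_mul, abs_of_nonneg hτ0]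
    calc τ * |a i| ≤ 1 * |a i| := mul_le_mul_of_nonneg_right hτ1 (abs_nonneg _)
      _ = |a i| := one_mul _
      _ ≤ 2 * d * (-(-(D * t) - Real.log d)) := ha i
      _ ≤ 2 * d * ((D + Real.log d) * t) := by
          refine mul_le_mul_of_nonneg_left ?_ (by positivity)
          nlinarith
      _ = 2 * d * (D + Real.log d) * t := by ring
  · rw [hτ', Real.exp_lt_exp]
    linarith
  · rw [hτ', Real.exp_lt_exp]
    linarith
end

section
/- Let d ≥ 1. For every invertible d×d real matrix V there exists a permutation σ of {1,…,d} such that for every j ∈ {1,…,d}: det(M_j)² ≥ (1/(d!)²) · det(V_jᵀ·V_j), where M_j is the top-left j×j block of the matrix obtained from V by permuting its rows according to σ (row i of the new matrix is row σ(i) of V), and V_j is the d×j matrix formed by the first j columns of V (so det(V_jᵀ·V_j) is the Gram determinant of the first j columns of V). -/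
open Matrix

/-- **QR decomposition**: every real square matrix is the product of an orthogonal matrix and an
upper triangular one. -/
theorem exists_orthogonal_mul_upperTriangular {d : ℕ} (V : Matrix (Fin d) (Fin d) ℝ) :
    ∃ Q R : Matrix (Fin d) (Fin d) ℝ, V = Q * R ∧ Qᵀ * Q = 1 ∧ ∀ m k, k < m → R m k = 0 := by
  let f : Fin d → EuclideanSpace ℝ (Fin d) := fun k => WithLp.toLp 2 fun i => V i k
  let b := InnerProductSpace.gramSchmidtOrthonormalBasis (𝕜 := ℝ)
    (by simp : Module.finrank ℝ (EuclideanSpace ℝ (Fin d)) = Fintype.card (Fin d)) f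
  refine ⟨of fun i m => b m i, of fun m k => inner ℝ (b m) (f k), ?_, ?_, ?_⟩
  · ext i k
    have h := congrArg (fun x : EuclideanSpace ℝ (Fin d) => x i) (b.sum_repr' (f k))
    simpa [f, mul_apply, mul_comm] using h.symm
  · ext m k
    have h := orthonormal_iff_ite.mp b.orthonormal k m
    simpa [mul_apply, one_apply, PiLp.inner_apply, eq_comm] using h
  · intro m k hkm
    exact InnerProductSpace.gramSchmidtOrthonormalBasis_inv_triangular _ f hkm

theorem abs_apply_le_one_of_transpose_mul_self_eq_one {m n : Type*} [Fintype m] [DecidableEq n]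
    {Q : Matrix m n ℝ} (hQ : Qᵀ * Q = 1) (i : m) (k : n) : |Q i k| ≤ 1 := by
  have h : ∑ l, Q l k * Q l k = 1 := by
    simpa [mul_apply] using congrFun (congrFun hQ k) k
  have hle : Q i k * Q i k ≤ 1 := h ▸
    Finset.single_le_sum (f := fun l => Q l k * Q l k) (fun l _ => mul_self_nonneg _)
      (Finset.mem_univ i)
  exact abs_le_one_iff_mul_self_le_one.mpr hle

/-- Restricting to an initial segment of columns is compatible with right multiplication by an
upper triangular matrix. -/
theorem submatrix_castLE_mul_of_upperTriangular {ι κ : Type*} {d j : ℕ} (hj : j ≤ d)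
    (Q : Matrix ι (Fin d) ℝ) {R : Matrix (Fin d) (Fin d) ℝ} (hR : ∀ m k, k < m → R m k = 0)
    (f : κ → ι) :
    (Q * R).submatrix f (Fin.castLE hj) =
      Q.submatrix f (Fin.castLE hj) * R.submatrix (Fin.castLE hj) (Fin.castLE hj) := by
  ext i k
  simp only [submatrix_apply, mul_apply]
  refine (Fintype.sum_of_injective (Fin.castLE hj) (Fin.castLE_injective hj) _ _ ?_
    fun _ => rfl).symm
  intro m hm
  have hjm : j ≤ (m : ℕ) := by
    by_contra! h
    exact hm ⟨⟨m, h⟩, rfl⟩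
  have hkm : Fin.castLE hj k < m := Fin.lt_def.mpr (lt_of_lt_of_le k.isLt hjm)
  rw [hR m _ hkm, mul_zero]

/-- If the last column has entries bounded by `1`, some minor along it is at least the average. -/
theorem exists_abs_det_le_succ_mul_minor {n : ℕ} (A : Matrix (Fin (n + 1)) (Fin (n + 1)) ℝ)
    (hA : ∀ i, |A i (Fin.last n)| ≤ 1) :
    ∃ i : Fin (n + 1), |A.det| ≤ (n + 1) * |(A.submatrix i.succAbove Fin.castSucc).det| := by
  obtain ⟨i, -, hi⟩ := Finset.exists_max_image Finset.univ
    (fun i : Fin (n + 1) => |(A.submatrix i.succAbove Fin.castSucc).det|) Finset.univ_nonempty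
  refine ⟨i, ?_⟩
  rw [det_succ_column A (Fin.last n)]
  refine (Finset.abs_sum_le_sum_abs _ _).trans ?_
  refine (Finset.sum_le_card_nsmul _ _ |(A.submatrix i.succAbove Fin.castSucc).det|
    fun l hl => ?_).trans_eq (by simp)
  rw [abs_mul, abs_mul, abs_pow, abs_neg, abs_one, one_pow, one_mul, Fin.succAbove_last]
  exact (mul_le_of_le_one_left (abs_nonneg _) (hA l)).trans (hi l hl)

/-- The rows of a square matrix with entries bounded by `1` can be permuted so that all leading
principal minors are simultaneously bounded below in terms of the determinant. -/
theorem exists_perm_factorial_mul_abs_det_le {d : ℕ} (A : Matrix (Fin d) (Fin d) ℝ)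
    (hA : ∀ i k, |A i k| ≤ 1) :
    ∃ σ : Equiv.Perm (Fin d), ∀ (j : ℕ) (hj : j ≤ d),
      (j.factorial : ℝ) * |A.det| ≤
        d.factorial * |(A.submatrix (σ ∘ Fin.castLE hj) (Fin.castLE hj)).det| := by
  induction d with
  | zero =>
    refine ⟨1, fun j hj => ?_⟩
    obtain rfl := Nat.le_zero.mp hj
    simp
  | succ n ih =>
    obtain ⟨i, hi⟩ := exists_abs_det_le_succ_mul_minor A fun l => hA l _
    obtain ⟨τ, hτ⟩ := ih (A.submatrix i.succAbove Fin.castSucc) fun _ _ => hA _ _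
    let σ : Equiv.Perm (Fin (n + 1)) :=
      (finSuccEquivLast.trans (Equiv.optionCongr τ)).trans (finSuccEquiv' i).symm
    have hσ (k : Fin n) : σ k.castSucc = i.succAbove (τ k) := by simp [σ]
    refine ⟨σ, fun j hj => ?_⟩
    rcases hj.eq_or_lt with rfl | hlt
    · have h : (A.submatrix (σ ∘ Fin.castLE hj) (Fin.castLE hj)) = A.submatrix σ id := rfl
      rw [h, det_permute, abs_mul]
      rcases Int.units_eq_one_or (Equiv.Perm.sign σ) with h | h <;> simp [h]
    · have hjn : j ≤ n := Nat.lt_succ_iff.mp hlt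
      have h : A.submatrix (σ ∘ Fin.castLE hj) (Fin.castLE hj) =
          (A.submatrix i.succAbove Fin.castSucc).submatrix (τ ∘ Fin.castLE hjn)
            (Fin.castLE hjn) := by
        ext a b
        exact congrArg (fun x => A x _) (hσ (Fin.castLE hjn a))
      rw [h, Nat.factorial_succ, Nat.cast_mul, Nat.cast_succ, mul_assoc]
      calc (j.factorial : ℝ) * |A.det|
          ≤ j.factorial * ((n + 1) * |(A.submatrix i.succAbove Fin.castSucc).det|) := by gcongr
        _ = (n + 1) * (j.factorial * |(A.submatrix i.succAbove Fin.castSucc).det|) := by ring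
        _ ≤ _ := mul_le_mul_of_nonneg_left (hτ j hjn) (by positivity)

theorem stmt8 (d : ℕ) (hd : 1 ≤ d)
    (V : Matrix (Fin d) (Fin d) ℝ) (hV : IsUnit V.det) :
    ∃ σ : Equiv.Perm (Fin d), ∀ (j : ℕ), 1 ≤ j → ∀ (hj : j ≤ d),
      (1 / ((Nat.factorial d : ℝ)) ^ 2) *
        ((Matrix.of fun (i : Fin d) (k : Fin j) => V i (Fin.castLE hj k))ᵀ *
          (Matrix.of fun (i : Fin d) (k : Fin j) => V i (Fin.castLE hj k))).det
      ≤ (Matrix.of fun (i : Fin j) (k : Fin j) =>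
          V (σ (Fin.castLE hj i)) (Fin.castLE hj k)).det ^ 2 := by
  obtain ⟨Q, R, rfl, hQ, hR⟩ := exists_orthogonal_mul_upperTriangular V
  obtain ⟨σ, hσ⟩ := exists_perm_factorial_mul_abs_det_le Q
    (abs_apply_le_one_of_transpose_mul_self_eq_one hQ)
  refine ⟨σ, fun j _ hj => ?_⟩
  set S := R.submatrix (Fin.castLE hj) (Fin.castLE hj)
  set M := Q.submatrix (σ ∘ Fin.castLE hj) (Fin.castLE hj)
  have hcols : (of fun (i : Fin d) (k : Fin j) => (Q * R) i (Fin.castLE hj k)) =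
      Q.submatrix id (Fin.castLE hj) * S :=
    submatrix_castLE_mul_of_upperTriangular hj Q hR id
  have hminor : (of fun (i : Fin j) (k : Fin j) =>
      (Q * R) (σ (Fin.castLE hj i)) (Fin.castLE hj k)) = M * S :=
    submatrix_castLE_mul_of_upperTriangular hj Q hR (σ ∘ Fin.castLE hj)
  have horth : (Q.submatrix id (Fin.castLE hj))ᵀ * Q.submatrix id (Fin.castLE hj) = 1 := by
    rw [transpose_submatrix, ← submatrix_mul _ _ _ _ _ Function.bijective_id, hQ,
      submatrix_one _ (Fin.castLE_injective hj)]
  have hgram : ((Q.submatrix id (Fin.castLE hj) * S)ᵀ *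
      (Q.submatrix id (Fin.castLE hj) * S)).det = S.det ^ 2 := by
    rw [transpose_mul, Matrix.mul_assoc, ← Matrix.mul_assoc _ _ S, horth, Matrix.one_mul,
      det_mul, det_transpose, sq]
  have hdet : |Q.det| = 1 := by
    have h := congrArg det hQ
    rw [det_mul, det_transpose, det_one, ← sq] at h
    exact (pow_eq_one_iff_of_nonneg (abs_nonneg _) two_ne_zero).mp ((sq_abs _).trans h)
  have hM : 1 ≤ (d.factorial : ℝ) * |M.det| := by
    have h := hσ j hj
    rw [hdet, mul_one] at h
    exact (Nat.one_le_cast.mpr j.factorial_pos).trans h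
  have hM' : 1 ≤ (d.factorial : ℝ) ^ 2 * M.det ^ 2 := by
    rw [← sq_abs M.det, ← mul_pow]
    exact one_le_pow₀ hM
  rw [hcols, hminor, hgram, det_mul, mul_pow]
  refine mul_le_mul_of_nonneg_right ?_ (sq_nonneg _)
  rw [div_le_iff₀' (by positivity)]
  exact hM'
end

section
/- Let d ≥ 2. There exists a constant C > 0 depending only on d with the following property. For every g ∈ SL(d,ℝ) there exists a d×d permutation matrix w such that for every diagonal matrix b' = diag(b'_1,…,b'_d) with 0 < b'_1 < b'_2 < ⋯ < b'_d and b'_1·b'_2⋯b'_d = 1, setting b := w·b'·w⁻¹, the following holds: whenever g = n·a·k and g·b = n₁·a₁·k₁ where n and n₁ are upper triangular matrices with all diagonal entries equal to 1, a = diag(α_1,…,α_d) and a₁ = diag(β_1,…,β_d) are diagonal matrices with positive diagonal entries, and k and k₁ are orthogonal matrices, one has ∑_{i=1}^d (log β_i − log b'_i − log α_i)² ≤ C². -/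
open Matrix

/-- Gaussian elimination with column pivoting, from the last row up: an invertible matrix is, up to
a permutation of its columns, the product of an upper triangular matrix and a lower unitriangular
matrix whose entries have absolute value at most one. -/
theorem exists_perm_submatrix_eq_upper_mul_lower (d : ℕ) (K : Matrix (Fin d) (Fin d) ℝ)
    (hK : ∀ v, v ᵥ* K = 0 → v = 0) :
    ∃ (σ : Equiv.Perm (Fin d)) (U L : Matrix (Fin d) (Fin d) ℝ),
      U.IsUpperTriangular ∧ (∀ i j, i < j → L i j = 0) ∧ (∀ i, L i i = 1) ∧
      (∀ i j, |L i j| ≤ 1) ∧ K.submatrix id σ = U * L := by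
  induction d with
  | zero => exact ⟨1, 1, 1, fun i => i.elim0, fun i => i.elim0, fun i => i.elim0,
      fun i => i.elim0, by ext i; exact i.elim0⟩
  | succ m ih =>
    obtain ⟨j₀, hj₀⟩ := Finite.exists_max fun j => |K (Fin.last m) j|
    have hp : K (Fin.last m) j₀ ≠ 0 := by
      intro h0
      have hrow : Pi.single (Fin.last m) 1 ᵥ* K = 0 := by
        ext j
        simpa [h0] using hj₀ j
      simpa using congrFun (hK _ hrow) (Fin.last m)
    set e := Equiv.swap j₀ (Fin.last m)
    set K₁ := K.submatrix id e with hK₁def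
    have hpe : K₁ (Fin.last m) (Fin.last m) = K (Fin.last m) j₀ := by simp [K₁, e]
    have hmax : ∀ j, |K₁ (Fin.last m) j| ≤ |K₁ (Fin.last m) (Fin.last m)| := fun j => by
      rw [hpe]; exact hj₀ _
    rw [← hpe] at hp
    have hK₁ : ∀ v, v ᵥ* K₁ = 0 → v = 0 := by
      intro v hv
      refine hK v (funext fun j => ?_)
      have := congrFun hv (e.symm j)
      simpa [K₁, vecMul, dotProduct] using this
    clear_value K₁
    set p := K₁ (Fin.last m) (Fin.last m) with hpdef
    obtain ⟨τ, U, L, hU, hL, hL1, hLb, hUL⟩ := ih (Matrix.of fun i j =>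
      K₁ i.castSucc j.castSucc - K₁ i.castSucc (Fin.last m) * K₁ (Fin.last m) j.castSucc / p) (by
        intro v hv
        have h0 := hK₁ (Fin.snoc v (-(∑ i, v i * K₁ i.castSucc (Fin.last m)) / p)) (by
          ext j
          induction j using Fin.lastCases with
          | last =>
            simp only [vecMul, dotProduct, Fin.sum_univ_castSucc, Fin.snoc_castSucc, Fin.snoc_last,
              Pi.zero_apply]
            rw [← hpdef]
            field_simp
            ring
          | cast j =>
            have := congrFun hv j
            simp only [vecMul, dotProduct, of_apply, Pi.zero_apply, mul_sub,
              Finset.sum_sub_distrib] at this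
            simp only [vecMul, dotProduct, Fin.sum_univ_castSucc, Fin.snoc_castSucc, Fin.snoc_last,
              Pi.zero_apply]
            rw [← this, sub_eq_add_neg, neg_div, neg_mul, Finset.sum_div, Finset.sum_mul]
            congr 2
            exact Finset.sum_congr rfl fun i _ => by ring)
        ext i
        simpa using congrFun h0 i.castSucc)
    let τ' : Equiv.Perm (Fin (m + 1)) :=
      (finSuccEquivLast.trans τ.optionCongr).trans finSuccEquivLast.symm
    have hτc : ∀ j : Fin m, τ' j.castSucc = (τ j).castSucc := fun j => by simp [τ']
    have hτl : τ' (Fin.last m) = Fin.last m := by simp [τ']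
    have hKσ : K.submatrix id (τ'.trans e) = K₁.submatrix id τ' := by
      rw [hK₁def]; rfl
    refine ⟨τ'.trans e,
      Matrix.of (Fin.snoc (α := fun _ => Fin (m + 1) → ℝ)
        (fun i => Fin.snoc (α := fun _ => ℝ) (U i) (K₁ i.castSucc (Fin.last m)))
        (Fin.snoc (α := fun _ => ℝ) 0 p)),
      Matrix.of (Fin.snoc (α := fun _ => Fin (m + 1) → ℝ)
        (fun i => Fin.snoc (α := fun _ => ℝ) (L i) 0)
        (Fin.snoc (α := fun _ => ℝ) (fun j => K₁ (Fin.last m) (τ j).castSucc / p) 1)),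
      ?_, ?_, ?_, ?_, ?_⟩
    · intro i j hij
      change j < i at hij
      induction i using Fin.lastCases with
      | last =>
        induction j using Fin.lastCases with
        | last => simp at hij
        | cast j => simp
      | cast i =>
        induction j using Fin.lastCases with
        | last => exact absurd hij (Fin.castSucc_lt_last i).not_gt
        | cast j => simpa using hU (by simpa using hij)
    · intro i j hij
      induction i using Fin.lastCases with
      | last => exact absurd hij (Fin.le_last j).not_gt
      | cast i =>
        induction j using Fin.lastCases with
        | last => simp
        | cast j => simpa using hL i j (by simpa using hij)
    · intro i
      induction i using Fin.lastCases with
      | last => simp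
      | cast i => simpa using hL1 i
    · intro i j
      induction i using Fin.lastCases with
      | last =>
        induction j using Fin.lastCases with
        | last => simp
        | cast j =>
          simp only [of_apply, Fin.snoc_last, Fin.snoc_castSucc, abs_div]
          exact div_le_one_of_le₀ (hmax _) (abs_nonneg _)
      | cast i =>
        induction j using Fin.lastCases with
        | last => simp
        | cast j => simpa using hLb i j
    · rw [hKσ]
      ext i j
      induction i using Fin.lastCases with
      | last =>
        induction j using Fin.lastCases with
        | last => simp [mul_apply, Fin.sum_univ_castSucc, hτl, ← hpdef]
        | cast j => simp [mul_apply, Fin.sum_univ_castSucc, hτc, mul_div_cancel₀ _ hp]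
      | cast i =>
        induction j using Fin.lastCases with
        | last => simp [mul_apply, Fin.sum_univ_castSucc, hτl]
        | cast j =>
          have := congrFun (congrFun hUL i) j
          simp only [submatrix_apply, of_apply, id, mul_apply] at this
          simp only [submatrix_apply, id, mul_apply, of_apply, Fin.sum_univ_castSucc, hτc,
            Fin.snoc_castSucc, Fin.snoc_last]
          rw [← this]
          ring

theorem Matrix.IsUpperTriangular.mul_apply_self {m R : Type*} [Fintype m] [LinearOrder m]
    [NonUnitalNonAssocSemiring R] {A B : Matrix m m R} (hA : A.IsUpperTriangular)
    (hB : B.IsUpperTriangular) (i : m) : (A * B) i i = A i i * B i i := by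
  rw [mul_apply, Finset.sum_eq_single i _ (by simp)]
  intro j _ hji
  rcases hji.lt_or_gt with h | h
  · rw [hA h, zero_mul]
  · rw [hB h, mul_zero]

/-- If `M` is lower unitriangular with entries bounded by one and `T * M = S * Q` with `S`, `T`
upper triangular and `Q` orthogonal, then the diagonals of `S` and `T` are comparable. -/
theorem abs_log_diag_sub_log_diag_le {d : ℕ} {T M S Q : Matrix (Fin d) (Fin d) ℝ}
    (hT : T.IsUpperTriangular) (hS : S.IsUpperTriangular) (hT0 : ∀ i, T i i ≠ 0)
    (hS0 : ∀ i, S i i ≠ 0) (hM : ∀ i j, i < j → M i j = 0) (hM1 : ∀ i, M i i = 1)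
    (hMb : ∀ i j, |M i j| ≤ 1) (hQ : Q * Qᵀ = 1) (h : T * M = S * Q) (i : Fin d) :
    |Real.log (S i i) - Real.log (T i i)| ≤ d * Real.log d := by
  have hTdet : IsUnit T.det := by
    rw [det_of_isUpperTriangular hT, isUnit_iff_ne_zero]
    exact Finset.prod_ne_zero_iff.2 fun i _ => hT0 i
  have hTinv : (T⁻¹).IsUpperTriangular := by
    let _ := invertibleOfIsUnitDet T hTdet
    exact blockTriangular_inv_of_blockTriangular hT
  obtain ⟨R, hRdef⟩ : ∃ R, R = T⁻¹ * S := ⟨_, rfl⟩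
  have hR : R.IsUpperTriangular := hRdef ▸ BlockTriangular.mul hTinv hS
  have hTR : T * R = S := by rw [hRdef, mul_nonsing_inv_cancel_left _ _ hTdet]
  have hMR : M = R * Q := by
    rw [hRdef, Matrix.mul_assoc, ← h, nonsing_inv_mul_cancel_left _ _ hTdet]
  have hdiag : ∀ i, T i i * R i i = S i i := fun i => by rw [← hTR, hT.mul_apply_self hR]
  have hR0 : ∀ i, R i i ≠ 0 := fun i h0 => hS0 i (by rw [← hdiag, h0, mul_zero])
  have hgram : M * Mᵀ = R * Rᵀ := by
    rw [hMR, transpose_mul, Matrix.mul_assoc, ← Matrix.mul_assoc Q, hQ, Matrix.one_mul]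
  have hsum : ∑ i, Real.log (R i i) = 0 := by
    have hMdet : M.det = 1 := by
      rw [det_of_isLowerTriangular M fun i j hij => hM i j hij]
      simp [hM1]
    have hsq : R.det ^ 2 = 1 := by
      have := congrArg det hgram
      rw [det_mul, det_mul, det_transpose, det_transpose, hMdet] at this
      linarith
    rw [← Real.log_prod fun i _ => hR0 i, ← det_of_isUpperTriangular hR]
    rcases eq_or_eq_neg_of_sq_eq_sq _ 1 (hsq.trans (one_pow 2).symm) with h1 | h1 <;> simp [h1]
  have hd : (1 : ℝ) ≤ d := by exact_mod_cast i.pos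
  have hlogd : 0 ≤ Real.log d := Real.log_nonneg hd
  have hupper : ∀ i, Real.log (R i i) ≤ Real.log d := by
    intro i
    have hsq : R i i ^ 2 ≤ d := by
      calc R i i ^ 2 ≤ ∑ j, R i j ^ 2 :=
            Finset.single_le_sum (f := fun j => R i j ^ 2) (fun j _ => sq_nonneg _)
              (Finset.mem_univ i)
        _ = ∑ j, M i j ^ 2 := by
            have := congrFun (congrFun hgram i) i
            simpa [mul_apply, ← sq] using this.symm
        _ ≤ ∑ _j : Fin d, (1 : ℝ) :=
            Finset.sum_le_sum fun j _ => (sq_le_one_iff_abs_le_one _).2 (hMb i j)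
        _ = d := by simp
    have := Real.log_le_log (by have := hR0 i; positivity) hsq
    rw [Real.log_pow] at this
    push_cast at this
    linarith
  have hlog : Real.log (S i i) - Real.log (T i i) = Real.log (R i i) := by
    rw [← hdiag, Real.log_mul (hT0 i) (hR0 i)]
    ring
  rw [hlog, abs_le]
  constructor
  · have hrest : ∑ j ∈ Finset.univ.erase i, Real.log (R j j) ≤ d * Real.log d := by
      calc _ ≤ ∑ _j ∈ Finset.univ.erase i, Real.log d := Finset.sum_le_sum fun j _ => hupper j
        _ ≤ ∑ _j : Fin d, Real.log d :=
            Finset.sum_le_sum_of_subset_of_nonneg (Finset.erase_subset _ _) fun _ _ _ => hlogd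
        _ = d * Real.log d := by simp
    have := Finset.add_sum_erase Finset.univ (fun j => Real.log (R j j)) (Finset.mem_univ i)
    simp only [hsum] at this
    linarith
  · exact (hupper i).trans (le_mul_of_one_le_left hlogd hd)

theorem submatrix_id_mul_transpose_self {m n R : Type*} [Fintype m] [Fintype n] [DecidableEq n]
    [CommSemiring R] {Q : Matrix n m R} (hQ : Q * Qᵀ = 1) (σ : Equiv.Perm m) :
    Q.submatrix id σ * (Q.submatrix id σ)ᵀ = 1 := by
  rw [transpose_submatrix, submatrix_mul_equiv, hQ, submatrix_id_id]


theorem stmt9 (d : ℕ) (hd : 2 ≤ d) :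
    ∃ C > (0 : ℝ), ∀ g : Matrix (Fin d) (Fin d) ℝ, g.det = 1 →
      ∃ σ : Equiv.Perm (Fin d), ∀ b' : Fin d → ℝ,
        (∀ i, 0 < b' i) → StrictMono b' → (∏ i, b' i) = 1 →
        ∀ (n n₁ k k₁ : Matrix (Fin d) (Fin d) ℝ) (α β : Fin d → ℝ),
          (∀ i, n i i = 1) → (∀ i j : Fin d, j < i → n i j = 0) →
          (∀ i, n₁ i i = 1) → (∀ i j : Fin d, j < i → n₁ i j = 0) →
          (∀ i, 0 < α i) → (∀ i, 0 < β i) →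
          k ∈ Matrix.orthogonalGroup (Fin d) ℝ →
          k₁ ∈ Matrix.orthogonalGroup (Fin d) ℝ →
          g = n * Matrix.diagonal α * k →
          g * Matrix.diagonal (fun i => b' (σ i)) = n₁ * Matrix.diagonal β * k₁ →
          ∑ i, (Real.log (β i) - Real.log (b' i) - Real.log (α i)) ^ 2 ≤ C ^ 2 := by
  have hd1 : (1 : ℝ) < d := by exact_mod_cast hd
  have hlogd : 0 < Real.log d := Real.log_pos hd1
  have hd0 : (0 : ℝ) < d := by linarith
  refine ⟨d * (2 * (d * Real.log d)), by positivity, fun g hg => ?_⟩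
  obtain ⟨τ, U, L, hU, hL, hL1, hLb, hUL⟩ := exists_perm_submatrix_eq_upper_mul_lower d g
    fun v hv => eq_zero_of_vecMul_eq_zero (by simp [hg]) hv
  have hU0 : ∀ i, U i i ≠ 0 := by
    have hdet : U.det ≠ 0 := by
      intro h0
      have := congrArg det hUL
      rw [det_mul, h0, zero_mul] at this
      have hperm := det_permute' τ g
      rw [this, hg] at hperm
      rcases Int.units_eq_one_or (Equiv.Perm.sign τ) with h | h <;> simp [h] at hperm
    rw [det_of_isUpperTriangular hU] at hdet
    exact fun i => Finset.prod_ne_zero_iff.1 hdet i (Finset.mem_univ i)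
  refine ⟨τ.symm, fun b' hb hmono _ n n₁ k k₁ α β hndiag hn hn₁diag hn₁ hα hβ hk hk₁ hgk hgk₁ => ?_⟩
  have hupper : ∀ {A : Matrix (Fin d) (Fin d) ℝ} (a : Fin d → ℝ),
      (∀ i j : Fin d, j < i → A i j = 0) → (A * diagonal a).IsUpperTriangular :=
    fun a hA => BlockTriangular.mul (fun i j hij => hA i j hij) (blockTriangular_diagonal a)
  have hα' : ∀ i, |Real.log (α i) - Real.log (U i i)| ≤ d * Real.log d := by
    intro i
    have := abs_log_diag_sub_log_diag_le (S := n * diagonal α) (Q := k.submatrix id τ) hU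
      (hupper α hn) hU0 (fun i => by simpa [hndiag] using (hα i).ne') hL hL1 hLb
      (submatrix_id_mul_transpose_self ((mem_orthogonalGroup_iff _ _).1 hk) τ)
      (by rw [← hUL, hgk]; rfl) i
    simpa [hndiag] using this
  have hβ' : ∀ i, |Real.log (β i) - (Real.log (U i i) + Real.log (b' i))| ≤ d * Real.log d := by
    intro i
    have := abs_log_diag_sub_log_diag_le (T := U * diagonal b')
      (M := Matrix.of fun i j => L i j * b' j / b' i)
      (S := n₁ * diagonal β) (Q := k₁.submatrix id τ)
      (hupper b' fun i j hij => hU hij) (hupper β hn₁)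
      (fun i => by simpa using ⟨hU0 i, (hb i).ne'⟩)
      (fun i => by simpa [hn₁diag] using (hβ i).ne') (fun i j hij => by simp [hL i j hij])
      (fun i => by simp [hL1, (hb i).ne'])
      (fun i j => by
        rcases lt_or_ge i j with hij | hij
        · simp [hL i j hij]
        · rw [of_apply, abs_div, abs_mul, abs_of_pos (hb i), abs_of_pos (hb j),
            div_le_one (hb i)]
          exact (mul_le_of_le_one_left (hb j).le (hLb i j)).trans (hmono.monotone hij))
      (submatrix_id_mul_transpose_self ((mem_orthogonalGroup_iff _ _).1 hk₁) τ)
      (by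
        have hsub : n₁ * diagonal β * k₁.submatrix id τ =
            (g * diagonal fun i => b' (τ.symm i)).submatrix id τ := by rw [hgk₁]; rfl
        rw [hsub]
        ext i j
        have := congrFun (congrFun hUL i) j
        simp only [submatrix_apply, id, mul_apply (M := U)] at this
        simp only [submatrix_apply, id, mul_diagonal, mul_apply (M := U * diagonal b'), of_apply,
          this, Equiv.symm_apply_apply, Finset.sum_mul]
        refine Finset.sum_congr rfl fun l _ => ?_
        have := (hb l).ne'
        field_simp) i
    simpa [hn₁diag, Real.log_mul (hU0 i) (hb i).ne'] using this
  calc ∑ i, (Real.log (β i) - Real.log (b' i) - Real.log (α i)) ^ 2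
      ≤ ∑ _i : Fin d, (2 * (d * Real.log d)) ^ 2 := by
        refine Finset.sum_le_sum fun i _ => sq_le_sq' ?_ ?_ <;>
          linarith [abs_le.1 (hα' i), abs_le.1 (hβ' i)]
    _ = d * (2 * (d * Real.log d)) ^ 2 := by simp
    _ ≤ d ^ 2 * (2 * (d * Real.log d)) ^ 2 := by
        gcongr
        nlinarith
    _ = (d * (2 * (d * Real.log d))) ^ 2 := by ring
end
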